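/- arXiv:0811.4205 — 10 statements merged into one kernel-verified Lean document; each statement's English description precedes it below -/
import Mathlib

section
/- Let N ≥ 1 and 1 ≤ n ≤ N−1 be integers and β ∈ ℂ with |β| < 1. Define ẑ : ℤ → ℂ by ẑ(n + jN) = (1 + N(−j−1)/(N−n))·conj(β)^(−j−1) for integers j ≤ −1, ẑ(n + jN) = C·(1 + Nj/n)·β^(j+1) for integers j ≥ 0, where C = −nN/((N−n)·(n + (N−n)|β|²)), and ẑ(k) = 0 if k is not congruent to n modulo N. Then for every k ∈ ℤ the series Σ_{l∈ℤ} û(k−l)·ẑ(l) converges absolutely and k·(|k|·ẑ(k) − Σ_{l∈ℤ} û(k−l)·ẑ(l)) = n(N−n)·ẑ(k); that is, ẑ is an eigenvector of the linearized Benjamin–Ono operator BA with eigenvalue ω_{N,n} = n(N−n). -/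
open Complex

/-- Fourier coefficients of the `N`-hump stationary solution of Benjamin–Ono. -/
noncomputable def uhat (N : ℕ) (β : ℂ) (k : ℤ) : ℂ :=
  if k = 0 then (N : ℂ) * (((1 - 3 * ‖β‖ ^ 2) / (1 - ‖β‖ ^ 2) : ℝ) : ℂ)
  else if (N : ℤ) ∣ k then
    if 0 < k then 2 * (N : ℂ) * β ^ ((k / (N : ℤ)).toNat)
    else 2 * (N : ℂ) * (starRingEnd ℂ β) ^ ((|k| / (N : ℤ)).toNat)
  else 0

/-- The eigenvector `ẑ_{N,n}` for `1 ≤ n ≤ N-1`. -/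
noncomputable def zhat (N n : ℕ) (β : ℂ) (k : ℤ) : ℂ :=
  if (N : ℤ) ∣ (k - (n : ℤ)) then
    let j : ℤ := (k - (n : ℤ)) / (N : ℤ)
    if 0 ≤ j then
      (-((n : ℂ) * (N : ℂ)) /
          (((N : ℂ) - (n : ℂ)) * ((n : ℂ) + ((N : ℂ) - (n : ℂ)) * ((‖β‖ : ℂ)) ^ 2))) *
        (1 + (N : ℂ) * (j : ℂ) / (n : ℂ)) * β ^ ((j + 1).toNat)
    else
      (1 + (N : ℂ) * ((-j - 1 : ℤ) : ℂ) / ((N : ℂ) - (n : ℂ))) *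
        (starRingEnd ℂ β) ^ ((-j - 1).toNat)
  else 0


lemma uhat_nat_zero (N : ℕ) (β : ℂ) :
    uhat N β 0 = (N : ℂ) * ((1 - 3 * (‖β‖ : ℂ) ^ 2) / (1 - (‖β‖ : ℂ) ^ 2)) := by
  simp [uhat]

lemma uhat_pos (N : ℕ) (hN : 1 ≤ N) (β : ℂ) (k : ℤ) (i : ℕ) (hi : 0 < i)
    (hk : k = (i : ℤ) * N) : uhat N β k = 2 * (N : ℂ) * β ^ i := by
  have hN' : (0 : ℤ) < N := by exact_mod_cast hN
  have hi' : (0 : ℤ) < i := by exact_mod_cast hi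
  have hk0 : 0 < k := by rw [hk]; positivity
  have hd : (N : ℤ) ∣ k := ⟨i, by rw [hk]; ring⟩
  have hq : k / (N : ℤ) = i := by rw [hk]; exact Int.mul_ediv_cancel _ hN'.ne'
  simp [uhat, hk0.ne', hd, hk0, hq]

lemma uhat_neg (N : ℕ) (hN : 1 ≤ N) (β : ℂ) (k : ℤ) (i : ℕ) (hi : 0 < i)
    (hk : k = -((i : ℤ) * N)) : uhat N β k = 2 * (N : ℂ) * (starRingEnd ℂ β) ^ i := by
  have hN' : (0 : ℤ) < N := by exact_mod_cast hN
  have hi' : (0 : ℤ) < i := by exact_mod_cast hi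
  have hp : 0 < (i : ℤ) * N := by positivity
  have hk0 : k < 0 := by rw [hk]; omega
  have hd : (N : ℤ) ∣ k := ⟨-i, by rw [hk]; ring⟩
  have ha : |k| = (i : ℤ) * N := by rw [hk, abs_neg, abs_of_pos hp]
  have hq : |k| / (N : ℤ) = i := by rw [ha]; exact Int.mul_ediv_cancel _ hN'.ne'
  simp only [uhat, hk0.ne, hd, hk0.not_gt, hq, if_true, if_false, Int.toNat_natCast]

lemma zhat_pos (N n : ℕ) (hN : 1 ≤ N) (β : ℂ) (k : ℤ) (j : ℕ)
    (hk : k = n + (j : ℤ) * N) : zhat N n β k =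
      (-((n : ℂ) * (N : ℂ)) /
          (((N : ℂ) - (n : ℂ)) * ((n : ℂ) + ((N : ℂ) - (n : ℂ)) * ((‖β‖ : ℂ)) ^ 2))) *
        (1 + (N : ℂ) * (j : ℂ) / (n : ℂ)) * β ^ (j + 1) := by
  have hN' : (0 : ℤ) < N := by exact_mod_cast hN
  have hs : k - n = (j : ℤ) * N := by rw [hk]; ring
  have hd : (N : ℤ) ∣ k - n := ⟨j, by rw [hs]; ring⟩
  have hq : (k - n) / (N : ℤ) = j := by rw [hs]; exact Int.mul_ediv_cancel _ hN'.ne'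
  have ht : ((j : ℤ) + 1).toNat = j + 1 := by omega
  simp only [zhat, hd, hq, if_true, ht, Int.natCast_nonneg, Int.cast_natCast]

lemma zhat_neg (N n : ℕ) (hN : 1 ≤ N) (β : ℂ) (k : ℤ) (p : ℕ)
    (hk : k = n + (-((p : ℤ) + 1)) * N) : zhat N n β k =
      (1 + (N : ℂ) * (p : ℂ) / ((N : ℂ) - (n : ℂ))) * (starRingEnd ℂ β) ^ p := by
  have hN' : (0 : ℤ) < N := by exact_mod_cast hN
  have hs : k - n = (-((p : ℤ) + 1)) * N := by rw [hk]; ring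
  have hd : (N : ℤ) ∣ k - n := ⟨-((p : ℤ) + 1), by rw [hs]; ring⟩
  have hq : (k - n) / (N : ℤ) = -((p : ℤ) + 1) := by
    rw [hs]; exact Int.mul_ediv_cancel _ hN'.ne'
  have h0 : ¬ (0 : ℤ) ≤ -((p : ℤ) + 1) := by omega
  have ht : (- -((p : ℤ) + 1) - 1) = p := by ring
  simp only [zhat, hd, hq, if_true, h0, if_false, ht, Int.cast_natCast, Int.toNat_natCast]

lemma hs_congr {ι : Type} {f g : ι → ℂ} {a b : ℂ} (h : HasSum g b) (hf : ∀ x, f x = g x)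
    (ha : a = b) : HasSum f a := by
  rw [ha, funext hf]; exact h

lemma hasSum_lin_geom (r c d : ℂ) (hr : ‖r‖ < 1) :
    HasSum (fun p : ℕ => (c + d * p) * r ^ p) (c / (1 - r) + d * r / (1 - r) ^ 2) := by
  have h1 := (hasSum_geometric_of_norm_lt_one hr).mul_left c
  have h2 := (hasSum_coe_mul_geometric_of_norm_lt_one hr).mul_left d
  refine hs_congr (h1.add h2) ?_ ?_
  · intro p; ring
  · ring

lemma sum_lin (c d : ℂ) (m : ℕ) :
    ∑ j ∈ Finset.range m, (c + d * (j : ℂ)) = c * m + d * (m * (m - 1)) / 2 := by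
  induction m with
  | zero => simp
  | succ k ih => rw [Finset.sum_range_succ, ih]; push_cast; ring

lemma hasSum_diag (x y r c d α : ℂ) (hxy : x * y = r) (hr : ‖r‖ < 1) (m : ℕ) (f : ℕ → ℂ)
    (h1 : ∀ j, j < m → f j = 2 * x ^ (m - j) * ((c + d * j) * x ^ j))
    (h2 : f m = α * ((c + d * m) * x ^ m))
    (h3 : ∀ q : ℕ, f (q + 1 + m) = 2 * y ^ (q + 1) * ((c + d * (q + 1 + m : ℕ)) * x ^ (q + 1 + m))) :
    HasSum f (x ^ m * (α * (c + d * m) + 2 * (c * m + d * (m * (m - 1)) / 2)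
      + 2 * ((c + d * m) * r / (1 - r) + d * r / (1 - r) ^ 2))) := by
  have hr1 : (1 : ℂ) - r ≠ 0 := by
    intro h
    have : r = 1 := by linear_combination -h
    rw [this] at hr; simp at hr
  rw [← hasSum_nat_add_iff' (m + 1)]
  have hg := ((hasSum_lin_geom r (c + d * m + d) d hr).mul_left (2 * x ^ m * r))
  refine hs_congr hg ?_ ?_
  · intro q
    have : q + (m + 1) = q + 1 + m := by ring
    rw [this, h3, ← hxy]; push_cast; ring
  · rw [Finset.sum_range_succ, h2]
    have : ∑ j ∈ Finset.range m, f j = 2 * x ^ m * ∑ j ∈ Finset.range m, (c + d * (j : ℂ)) := by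
      rw [Finset.mul_sum]
      refine Finset.sum_congr rfl fun j hj => ?_
      have hj' := Finset.mem_range.mp hj
      have : x ^ m = x ^ (m - j) * x ^ j := by rw [← pow_add]; congr 1; omega
      rw [h1 j hj', this]; ring
    rw [this, sum_lin]
    field_simp
    ring

lemma hasSum_off (x y r c d e : ℂ) (hxy : x * y = r) (hr : ‖r‖ < 1) (m : ℕ) (f : ℕ → ℂ)
    (h : ∀ p, f p = e * (2 * x ^ (m + 1 + p) * ((c + d * p) * y ^ p))) :
    HasSum f (e * (2 * x ^ (m + 1)) * (c / (1 - r) + d * r / (1 - r) ^ 2)) := by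
  refine hs_congr ((hasSum_lin_geom r c d hr).mul_left (e * (2 * x ^ (m + 1)))) ?_ rfl
  intro p
  rw [h, ← hxy]; ring

/-- Value of the convolution at `k = n + m N`, reindexed along the arithmetic progression. -/
lemma conv_reindex (N n : ℕ) (hN : 1 ≤ N) (β : ℂ) (k : ℤ) (S : ℂ)
    (h : HasSum (fun j : ℤ => uhat N β (k - (n + j * N)) * zhat N n β (n + j * N)) S) :
    HasSum (fun l : ℤ => uhat N β (k - l) * zhat N n β l) S := by
  have hN' : (N : ℤ) ≠ 0 := by positivity
  have hinj : Function.Injective (fun j : ℤ => (n : ℤ) + j * N) := by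
    intro a b hab
    exact mul_right_cancel₀ hN' (add_left_cancel hab)
  refine (hinj.hasSum_iff ?_).mp h
  intro l hl
  have : ¬ (N : ℤ) ∣ l - n := by
    rintro ⟨j, hj⟩
    exact hl ⟨j, by simp only; linear_combination -hj⟩
  simp [zhat, this]

/-- `ẑ_{N,n}` with `1 ≤ n ≤ N-1` is an eigenvector of the linearized
Benjamin–Ono operator `BA` with eigenvalue `n(N-n)`. -/
theorem benjamin_ono_eigenvector_low (N n : ℕ) (hN : 1 ≤ N) (hn1 : 1 ≤ n)
    (hn2 : n ≤ N - 1) (β : ℂ) (hβ : ‖β‖ < 1) (k : ℤ) :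
    Summable (fun l : ℤ => ‖uhat N β (k - l) * zhat N n β l‖) ∧
    (k : ℂ) * (((|k| : ℤ) : ℂ) * zhat N n β k - ∑' l : ℤ, uhat N β (k - l) * zhat N n β l)
      = (n : ℂ) * ((N : ℂ) - (n : ℂ)) * zhat N n β k := by
  have hN' : (N : ℂ) ≠ 0 := by exact_mod_cast (by omega : N ≠ 0)
  have hn0 : (n : ℂ) ≠ 0 := by exact_mod_cast (by omega : n ≠ 0)
  have hnN : n < N := by omega
  have ha : (N : ℂ) - n ≠ 0 := by
    rw [sub_ne_zero]; exact_mod_cast hnN.ne'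
  have hb1 : ‖β‖ ^ 2 < 1 := by
    have := norm_nonneg β
    nlinarith
  have hD : (n : ℂ) + ((N : ℂ) - n) * (‖β‖ : ℂ) ^ 2 ≠ 0 := by
    have h1 : (0 : ℝ) < n := by exact_mod_cast hn1
    have h2 : (0 : ℝ) < (N : ℝ) - n := by rw [sub_pos]; exact_mod_cast hnN
    have h3 : (0 : ℝ) < n + (N - n) * ‖β‖ ^ 2 := by positivity
    exact_mod_cast h3.ne'
  have hr1 : (1 : ℂ) - (‖β‖ : ℂ) ^ 2 ≠ 0 := by
    have : (1 : ℝ) - ‖β‖ ^ 2 ≠ 0 := by linarith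
    exact_mod_cast this
  have hr : ‖((‖β‖ : ℂ) ^ 2)‖ < 1 := by simpa using hb1
  have hxy : β * starRingEnd ℂ β = (‖β‖ : ℂ) ^ 2 := Complex.mul_conj' β
  have hyx : starRingEnd ℂ β * β = (‖β‖ : ℂ) ^ 2 := by rw [mul_comm, hxy]
  have hZp := zhat_pos N n hN β
  have hU0 := uhat_nat_zero N β
  generalize hrdef : (‖β‖ : ℂ) ^ 2 = r at *
  suffices H : ∃ S, HasSum (fun l : ℤ => uhat N β (k - l) * zhat N n β l) S ∧
      (k : ℂ) * (((|k| : ℤ) : ℂ) * zhat N n β k - S)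
        = (n : ℂ) * ((N : ℂ) - (n : ℂ)) * zhat N n β k by
    obtain ⟨S, hS, hE⟩ := H
    exact ⟨summable_norm_iff.mpr hS.summable, by rw [hS.tsum_eq]; exact hE⟩
  by_cases hd : (N : ℤ) ∣ k - n
  swap
  · have hz : zhat N n β k = 0 := by simp [zhat, hd]
    refine ⟨0, ?_, by simp [hz]⟩
    apply conv_reindex N n hN
    refine hs_congr hasSum_zero (fun j => ?_) rfl
    have h1 : ¬ (N : ℤ) ∣ k - (n + j * N) := by
      intro h
      apply hd
      have := dvd_add h (Dvd.intro_left j rfl : (N : ℤ) ∣ j * N)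
      have e : k - (n + j * N) + j * N = k - n := by ring
      rwa [e] at this
    have h2 : k - (n + j * N) ≠ 0 := fun h => h1 (h ▸ dvd_zero _)
    simp [uhat, h1, h2]
  obtain ⟨m', hm'⟩ := hd
  rcases lt_or_ge m' 0 with hneg | hpos
  · obtain ⟨s, rfl⟩ : ∃ s : ℕ, m' = -((s : ℤ) + 1) := ⟨(-m' - 1).toNat, by omega⟩
    have hk : k = n + (-((s : ℤ) + 1)) * N := by linear_combination hm'
    have hkneg : k < 0 := by
      rw [hk]; nlinarith [(by exact_mod_cast hnN : (n : ℤ) < N), Int.natCast_nonneg s]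
    have hA := hasSum_diag (starRingEnd ℂ β) β r (N : ℂ) (N * (N / (N - n)))
      ((1 - 3 * r) / (1 - r)) hyx hr s
      (fun p : ℕ => uhat N β (k - (n + (-((p : ℤ) + 1)) * N)) *
        zhat N n β (n + (-((p : ℤ) + 1)) * N))
      (fun j hj => by
        rw [zhat_neg N n hN β _ j rfl, uhat_neg N hN β _ (s - j) (by omega)
          (by rw [hk]; push_cast [hj.le]; ring)]
        ring)
      (by
        rw [zhat_neg N n hN β _ s rfl, ← hk, sub_self, hU0]
        ring)
      (fun q => by
        rw [zhat_neg N n hN β _ (q + 1 + s) rfl, uhat_pos N hN β _ (q + 1) (by omega)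
          (by rw [hk]; push_cast; ring)]
        ring)
    have hB := hasSum_off (starRingEnd ℂ β) β r 1 (N / n)
      (N * β * (-((n : ℂ) * N) / ((N - n) * (n + (N - n) * r)))) hyx hr s
      (fun j : ℕ => uhat N β (k - (n + (j : ℤ) * N)) * zhat N n β (n + (j : ℤ) * N))
      (fun j => by
        rw [hZp _ j rfl, uhat_neg N hN β _ (s + 1 + j) (by omega)
          (by rw [hk]; push_cast; ring)]
        ring)
    refine ⟨_, conv_reindex N n hN β k _ (HasSum.of_nat_of_neg_add_one hB hA), ?_⟩
    have hkc : (k : ℂ) = n - (s + 1) * N := by rw [hk]; push_cast; ring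
    rw [zhat_neg N n hN β k s hk, abs_of_neg hkneg]
    push_cast
    rw [hkc, pow_succ]
    have e1 : (N : ℂ) * β * (-((n : ℂ) * N) / ((N - n) * (n + (N - n) * r))) *
        (2 * (starRingEnd ℂ β ^ s * starRingEnd ℂ β)) = starRingEnd ℂ β ^ s *
        (2 * N * r * (-((n : ℂ) * N) / ((N - n) * (n + (N - n) * r)))) := by
      rw [← hxy]; ring
    rw [e1]
    generalize starRingEnd ℂ β ^ s = X
    field_simp
    ring
  · obtain ⟨m, rfl⟩ : ∃ m : ℕ, m' = m := ⟨m'.toNat, by omega⟩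
    have hk : k = n + (m : ℤ) * N := by linear_combination hm'
    have hkpos : 0 ≤ k := by rw [hk]; positivity
    have hA := hasSum_diag β (starRingEnd ℂ β) r
      (N * β * (-((n : ℂ) * N) / ((N - n) * (n + (N - n) * r))))
      (N * β * (-((n : ℂ) * N) / ((N - n) * (n + (N - n) * r))) * (N / n))
      ((1 - 3 * r) / (1 - r)) hxy hr m
      (fun j : ℕ => uhat N β (k - (n + (j : ℤ) * N)) * zhat N n β (n + (j : ℤ) * N))
      (fun j hj => by
        rw [hZp _ j rfl, uhat_pos N hN β _ (m - j) (by omega)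
          (by rw [hk]; push_cast [hj.le]; ring)]
        ring)
      (by
        rw [hZp _ m rfl, ← hk, sub_self, hU0]
        ring)
      (fun q => by
        rw [hZp _ (q + 1 + m) rfl, uhat_neg N hN β _ (q + 1) (by omega)
          (by rw [hk]; push_cast; ring)]
        ring)
    have hB := hasSum_off β (starRingEnd ℂ β) r 1 (N / (N - n)) N hxy hr m
      (fun p : ℕ => uhat N β (k - (n + (-((p : ℤ) + 1)) * N)) *
        zhat N n β (n + (-((p : ℤ) + 1)) * N))
      (fun p => by
        rw [zhat_neg N n hN β _ p rfl, uhat_pos N hN β _ (m + 1 + p) (by omega)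
          (by rw [hk]; push_cast; ring)]
        ring)
    refine ⟨_, conv_reindex N n hN β k _ (HasSum.of_nat_of_neg_add_one hA hB), ?_⟩
    have hkc : (k : ℂ) = n + m * N := by rw [hk]; push_cast; ring
    rw [hZp k m hk, abs_of_nonneg hkpos, hkc, pow_succ]
    generalize β ^ m = X
    field_simp
    ring
end

section
/- Let N ≥ 1 be an integer and β ∈ ℂ with |β| < 1. The sequence w(k) = k·û(k) (the Fourier coefficients of a scalar multiple of the x-derivative of the N-hump stationary solution) lies in the kernel of the linearized Benjamin–Ono operator BA: for every k ∈ ℤ the series Σ_{l∈ℤ} û(k−l)·w(l) converges absolutely and k·(|k|·w(k) − Σ_{l∈ℤ} û(k−l)·w(l)) = 0. -/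
open Complex

/-- The one-hump profile. -/
noncomputable def aa (β : ℂ) (m : ℤ) : ℂ :=
  if m = 0 then (((1 - 3 * ‖β‖ ^ 2) / (1 - ‖β‖ ^ 2) : ℝ) : ℂ)
  else if 0 < m then 2 * β ^ m.natAbs else 2 * (starRingEnd ℂ β) ^ m.natAbs

lemma uhat_mul (N : ℕ) (hN : 1 ≤ N) (β : ℂ) (m : ℤ) :
    uhat N β (N * m) = N * aa β m := by
  have hN' : (0 : ℤ) < N := by exact_mod_cast hN
  unfold uhat aa
  by_cases h0 : m = 0
  · simp [h0]
  have h1 : (N : ℤ) * m ≠ 0 := mul_ne_zero hN'.ne' h0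
  have hd : (N : ℤ) ∣ N * m := Dvd.intro _ rfl
  rw [if_neg h1, if_neg h0, if_pos hd]
  by_cases hp : 0 < m
  · rw [if_pos (mul_pos hN' hp), if_pos hp, Int.mul_ediv_cancel_left _ hN'.ne']
    have : m.toNat = m.natAbs := by omega
    rw [this]; ring
  · have : ¬ 0 < (N : ℤ) * m := by
      intro h; exact hp (pos_of_mul_pos_right h hN'.le)
    rw [if_neg this, if_neg hp, abs_mul, abs_of_pos hN', Int.mul_ediv_cancel_left _ hN'.ne']
    have : |m|.toNat = m.natAbs := by rw [Int.abs_eq_natAbs, Int.toNat_natCast]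
    rw [this]; ring

lemma uhat_not_dvd (N : ℕ) (β : ℂ) (k : ℤ) (h : ¬ (N : ℤ) ∣ k) : uhat N β k = 0 := by
  have h0 : k ≠ 0 := by rintro rfl; exact h (dvd_zero _)
  simp [uhat, h0, h]

lemma aa_neg (β : ℂ) (m : ℤ) : aa β (-m) = aa (starRingEnd ℂ β) m := by
  unfold aa
  rcases lt_trichotomy m 0 with h | h | h
  · simp [h.ne, h, h.not_gt]
  · simp [h]
  · simp [h.ne', h, h.not_gt]

lemma aa_pos (β : ℂ) (m : ℤ) (n : ℕ) (hn : 0 < n) (h : m = n) : aa β m = 2 * β ^ n := by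
  subst h
  have : (n : ℤ) ≠ 0 := by omega
  have h2 : (0 : ℤ) < n := by omega
  simp only [aa, if_neg this, if_pos h2, Int.natAbs_natCast]

lemma aa_negg (β : ℂ) (m : ℤ) (n : ℕ) (hn : 0 < n) (h : m = -n) :
    aa β m = 2 * (starRingEnd ℂ β) ^ n := by
  subst h
  rw [aa_neg, aa_pos _ _ n hn rfl]

lemma aa_bound (β : ℂ) : ∃ C : ℝ, 0 ≤ C ∧ ∀ m, ‖aa β m‖ ≤ C * ‖β‖ ^ m.natAbs := by
  refine ⟨‖aa β 0‖ + 2, by positivity, fun m => ?_⟩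
  have hq : 0 ≤ ‖β‖ ^ m.natAbs := by positivity
  have h0 := norm_nonneg (aa β 0)
  by_cases h : m = 0
  · subst h; simp
  · have : ‖aa β m‖ = 2 * ‖β‖ ^ m.natAbs := by
      unfold aa; rw [if_neg h]; split_ifs <;> simp
    rw [this]; nlinarith

lemma aa_summable (β : ℂ) (hβ : ‖β‖ < 1) (n : ℤ) :
    Summable (fun j : ℤ => ‖aa β (n - j) * ((j : ℂ) * aa β j)‖) := by
  obtain ⟨C, hC, hb⟩ := aa_bound β
  have hs : Summable (fun j : ℤ => C * (C * ((j.natAbs : ℝ) ^ 1 * ‖β‖ ^ j.natAbs))) := by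
    apply Summable.mul_left
    apply Summable.mul_left
    have := summable_pow_mul_geometric_of_norm_lt_one 1 (r := ‖β‖) (by simpa using hβ)
    apply Summable.of_nat_of_neg <;> simpa using this
  refine Summable.of_nonneg_of_le (fun _ => norm_nonneg _) (fun j => ?_) hs
  rw [norm_mul, norm_mul]
  have h1 : ‖aa β (n - j)‖ ≤ C := (hb _).trans
    (mul_le_of_le_one_right hC (pow_le_one₀ (norm_nonneg _) hβ.le))
  have h2 : ‖(j : ℂ)‖ = (j.natAbs : ℝ) := by
    rw [Complex.norm_intCast, Nat.cast_natAbs, Int.cast_abs]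
  rw [h2]
  refine mul_le_mul h1 ?_ (by positivity) hC
  have := mul_le_mul_of_nonneg_left (hb j) (Nat.cast_nonneg (α := ℝ) j.natAbs)
  linarith

lemma aa_conv_pos (β : ℂ) (hβ : ‖β‖ < 1) (m : ℕ) :
    HasSum (fun j : ℤ => aa β j * aa β ((m + 1 : ℕ) - j))
      (2 * ((m + 1 : ℕ) : ℂ) * aa β (m + 1 : ℕ)) := by
  set c := starRingEnd ℂ β with hc
  have hr : β * c = ((‖β‖ ^ 2 : ℝ) : ℂ) := by
    rw [hc, Complex.mul_conj, Complex.normSq_eq_norm_sq]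
  have hr1 : ‖β * c‖ < 1 := by
    rw [hc, norm_mul, RCLike.norm_conj]; nlinarith [norm_nonneg β]
  have hgeo := (hasSum_geometric_of_norm_lt_one hr1).mul_left (4 * β ^ (m + 1) * (β * c))
  have hne : (1 - β * c) ≠ 0 := by
    intro h
    have : β * c = 1 := by linear_combination -h
    rw [this] at hr1; simp at hr1
  have hneg : HasSum (fun i : ℕ => aa β (-((i : ℤ) + 1)) * aa β ((m + 1 : ℕ) - (-((i : ℤ) + 1))))
      (4 * β ^ (m + 1) * (β * c) * (1 - β * c)⁻¹) := by
    refine hgeo.congr_fun ?_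
    intro i
    rw [aa_negg β _ (i + 1) (by omega) (by push_cast; ring),
      aa_pos β _ (m + 1 + (i + 1)) (by omega) (by push_cast; ring), ← hc]
    ring
  have hpos : HasSum (fun i : ℕ => aa β (i : ℤ) * aa β ((m + 1 : ℕ) - (i : ℤ)))
      (4 * β ^ (m + 1) * (β * c) * (1 - β * c)⁻¹ + (4 * aa β 0 * β ^ (m + 1) + m * (4 * β ^ (m + 1)))) := by
    have hfin : ∑ i ∈ Finset.range (m + 2), aa β (i : ℤ) * aa β ((m + 1 : ℕ) - (i : ℤ))
        = 4 * aa β 0 * β ^ (m + 1) + m * (4 * β ^ (m + 1)) := by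
      rw [Finset.sum_range_succ, Finset.sum_range_succ']
      have : ∀ i ∈ Finset.range m, aa β ((i + 1 : ℕ) : ℤ) * aa β ((m + 1 : ℕ) - ((i + 1 : ℕ) : ℤ))
          = 4 * β ^ (m + 1) := by
        intro i hi
        rw [Finset.mem_range] at hi
        obtain ⟨d, rfl⟩ := Nat.exists_eq_add_of_lt hi
        rw [aa_pos β _ (i + 1) (by omega) rfl,
          aa_pos β _ (d + 1) (by omega) (by push_cast; ring)]
        ring
      rw [Finset.sum_congr rfl this, sub_self, aa_pos β ((m + 1 : ℕ) : ℤ) (m + 1) (by omega) rfl,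
        aa_pos β (((m + 1 : ℕ) : ℤ) - ((0 : ℕ) : ℤ)) (m + 1) (by omega) (by simp)]
      simp
      ring
    rw [← hfin]
    refine (hasSum_nat_add_iff (m + 2)).1 ?_
    refine hgeo.congr_fun ?_
    intro i
    rw [aa_pos β _ (i + (m + 2)) (by omega) rfl,
      aa_negg β _ (i + 1) (by omega) (by push_cast; ring), ← hc]
    ring
  have := HasSum.of_nat_of_neg_add_one (f := fun j : ℤ => aa β j * aa β ((m + 1 : ℕ) - j)) hpos hneg
  convert this using 1
  have h0 : aa β 0 = (1 - 3 * (β * c)) / (1 - β * c) := by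
    rw [hr]; simp [aa]
  rw [h0, aa_pos β _ (m + 1) (by omega) rfl]
  field_simp
  push_cast
  ring

lemma aa_conv (β : ℂ) (hβ : ‖β‖ < 1) (n : ℤ) (hn : n ≠ 0) :
    HasSum (fun j : ℤ => aa β j * aa β (n - j)) (2 * ((|n| : ℤ) : ℂ) * aa β n) := by
  rcases lt_or_gt_of_ne hn with h | h
  · obtain ⟨m, rfl⟩ : ∃ m : ℕ, n = -((m + 1 : ℕ) : ℤ) := ⟨(-n - 1).toNat, by omega⟩
    have := aa_conv_pos (starRingEnd ℂ β) (by simpa using hβ) m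
    rw [← (Equiv.neg ℤ).hasSum_iff]
    rw [abs_neg, Nat.abs_cast, aa_neg, Int.cast_natCast]
    refine this.congr_fun ?_
    intro j
    simp only [Function.comp, Equiv.neg_apply]
    rw [← aa_neg, ← aa_neg, show -(((m + 1 : ℕ) : ℤ) - j) = -((m + 1 : ℕ) : ℤ) - -j by ring]
  · obtain ⟨m, rfl⟩ : ∃ m : ℕ, n = ((m + 1 : ℕ) : ℤ) := ⟨(n - 1).toNat, by omega⟩
    rw [Nat.abs_cast, Int.cast_natCast]
    exact aa_conv_pos β hβ m

lemma aa_main (β : ℂ) (hβ : ‖β‖ < 1) (n : ℤ) (hn : n ≠ 0) :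
    ∑' j : ℤ, aa β (n - j) * ((j : ℂ) * aa β j) = ((|n| : ℤ) : ℂ) * (n * aa β n) := by
  have hS := (aa_summable β hβ n).of_norm.hasSum
  have hS' := (Equiv.subLeft n).hasSum_iff.2 hS
  have hT := (aa_conv β hβ n hn).mul_left (n : ℂ)
  have h := (hS.add hS').unique (hT.congr_fun ?_)
  · linear_combination h / 2
  · intro j
    simp only [Function.comp, Equiv.subLeft_apply, sub_sub_cancel]
    push_cast
    ring

/-- The sequence `w(k) = k·û(k)` (Fourier coefficients of a scalar multiple of
the derivative of the stationary solution) lies in the kernel of the linearized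
Benjamin–Ono operator `BA`. -/
theorem benjamin_ono_kernel_derivative (N : ℕ) (hN : 1 ≤ N) (β : ℂ) (hβ : ‖β‖ < 1)
    (k : ℤ) :
    Summable (fun l : ℤ => ‖uhat N β (k - l) * ((l : ℂ) * uhat N β l)‖) ∧
    (k : ℂ) * (((|k| : ℤ) : ℂ) * ((k : ℂ) * uhat N β k)
        - ∑' l : ℤ, uhat N β (k - l) * ((l : ℂ) * uhat N β l)) = 0 := by
  have hN' : (N : ℤ) ≠ 0 := by omega
  by_cases hd : (N : ℤ) ∣ k
  · obtain ⟨n, rfl⟩ := hd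
    have hinj : Function.Injective (fun j : ℤ => (N : ℤ) * j) := mul_right_injective₀ hN'
    have hz : ∀ x ∉ Set.range (fun j : ℤ => (N : ℤ) * j),
        uhat N β (N * n - x) * ((x : ℂ) * uhat N β x) = 0 := by
      intro x hx
      rw [uhat_not_dvd N β x (fun ⟨y, hy⟩ => hx ⟨y, hy.symm⟩)]; simp
    have hterm : ∀ j : ℤ, uhat N β (N * n - N * j) * (((N * j : ℤ) : ℂ) * uhat N β (N * j))
        = (N : ℂ) ^ 3 * (aa β (n - j) * ((j : ℂ) * aa β j)) := by
      intro j
      rw [← mul_sub, uhat_mul N hN, uhat_mul N hN]; push_cast; ring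
    refine ⟨?_, ?_⟩
    · rw [← hinj.summable_iff (fun x hx => by rw [hz x hx, norm_zero])]
      refine ((aa_summable β hβ n).mul_left (‖(N : ℂ) ^ 3‖)).congr ?_
      intro j
      simp only [Function.comp]
      rw [hterm, norm_mul ((N : ℂ) ^ 3)]
    · by_cases hn : n = 0
      · simp [hn]
      have : ∑' l : ℤ, uhat N β (N * n - l) * ((l : ℂ) * uhat N β l)
          = (N : ℂ) ^ 3 * (((|n| : ℤ) : ℂ) * (n * aa β n)) := by
        rw [← aa_main β hβ n hn, ← tsum_mul_left, ← hinj.tsum_eq]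
        · exact tsum_congr hterm
        · intro x hx
          by_contra h
          exact hx (hz x h)
      rw [this, uhat_mul N hN, abs_mul, Nat.abs_cast]
      push_cast
      ring
  · have hz : ∀ l : ℤ, uhat N β (k - l) * ((l : ℂ) * uhat N β l) = 0 := by
      intro l
      by_cases hl : (N : ℤ) ∣ l
      · rw [uhat_not_dvd N β (k - l) (fun h => hd ((dvd_sub_left hl).1 h))]; simp
      · rw [uhat_not_dvd N β l hl]; simp
    simp [hz, uhat_not_dvd N β k hd, summable_zero]
end

section
/- Let N ≥ 1 be an integer and r ∈ (0,1) a real number, and take β = r. The sequence w : ℤ → ℝ defined by w(0) = −4Nr/(1−r²)², w(k) = 2|k|·r^(|k|/N − 1) if k is a nonzero multiple of N, and w(k) = 0 otherwise (the derivative of û with respect to r, i.e. the Fourier coefficients of ∂u_stat/∂|β|) lies in the kernel of the linearized Benjamin–Ono operator BA: for every k ∈ ℤ the series Σ_{l∈ℤ} û(k−l)·w(l) converges absolutely and k·(|k|·w(k) − Σ_{l∈ℤ} û(k−l)·w(l)) = 0. Hence the zero eigenvalue of BA has geometric multiplicity at least two. -/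
open Complex

/-- Fourier coefficients of `∂u_stat/∂|β|` at `β = r ∈ (0,1)`. -/
noncomputable def wamp (N : ℕ) (r : ℝ) (k : ℤ) : ℝ :=
  if k = 0 then -4 * (N : ℝ) * r / (1 - r ^ 2) ^ 2
  else if (N : ℤ) ∣ k then 2 * ((|k| : ℤ) : ℝ) * r ^ ((|k| / (N : ℤ) - 1).toNat)
  else 0

lemma HasSum.congr_fun_bo {ι : Type*} {f g : ι → ℝ} {a : ℝ} (h : HasSum f a)
    (e : ∀ i, g i = f i) : HasSum g a := by
  rwa [show g = f from funext e]

lemma HasSum.congr_val_bo {ι : Type*} {f : ι → ℝ} {a b : ℝ} (h : HasSum f a)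
    (e : a = b) : HasSum f b := e ▸ h

lemma bo_gauss (n : ℕ) : ∑ j ∈ Finset.range n, (j : ℝ) = n * (n - 1) / 2 := by
  induction n with
  | zero => simp
  | succ k ih => rw [Finset.sum_range_succ, ih]; push_cast; ring

lemma bo_aux_nat (r : ℝ) (hr0 : 0 < r) (hr1 : r < 1) (n : ℕ) :
    HasSum (fun m : ℤ => r ^ ((n : ℤ) - m).natAbs * ((m.natAbs : ℝ) * r ^ m.natAbs))
      (r ^ n * (2 * (r ^ 2 / (1 - r ^ 2) ^ 2) + n * (n - 1) / 2 + n * (1 - r ^ 2)⁻¹)) := by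
  have hq0 : 0 ≤ r ^ 2 := by positivity
  have hq1 : r ^ 2 < 1 := by nlinarith
  have hqn : ‖r ^ 2‖ < 1 := by rw [Real.norm_of_nonneg hq0]; exact hq1
  have h1 : HasSum (fun j : ℕ => (j : ℝ) * (r ^ 2) ^ j) (r ^ 2 / (1 - r ^ 2) ^ 2) :=
    hasSum_coe_mul_geometric_of_norm_lt_one hqn
  have h0 : HasSum (fun j : ℕ => (r ^ 2) ^ j) (1 - r ^ 2)⁻¹ :=
    hasSum_geometric_of_lt_one hq0 hq1
  have hneg : HasSum (fun j : ℕ => r ^ ((n : ℤ) - (-((j : ℤ) + 1))).natAbs *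
      (((-((j : ℤ) + 1)).natAbs : ℝ) * r ^ (-((j : ℤ) + 1)).natAbs))
      (r ^ n * (r ^ 2 / (1 - r ^ 2) ^ 2)) := by
    have h2 := (hasSum_nat_add_iff' 1).2 h1
    simp only [Finset.range_one, Finset.sum_singleton, Nat.cast_zero, zero_mul, sub_zero] at h2
    refine (h2.mul_left (r ^ n)).congr_fun_bo ?_
    intro j
    have e1 : ((n : ℤ) - (-((j : ℤ) + 1))).natAbs = n + (j + 1) := by omega
    have e2 : (-((j : ℤ) + 1)).natAbs = j + 1 := by omega
    rw [e1, e2]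
    ring
  have hpos : HasSum (fun j : ℕ => r ^ ((n : ℤ) - (j : ℤ)).natAbs *
      ((((j : ℤ)).natAbs : ℝ) * r ^ ((j : ℤ)).natAbs))
      (r ^ n * (r ^ 2 / (1 - r ^ 2) ^ 2 + n * (n - 1) / 2 + n * (1 - r ^ 2)⁻¹)) := by
    rw [← hasSum_nat_add_iff' n]
    have hs : ∑ j ∈ Finset.range n, r ^ ((n : ℤ) - (j : ℤ)).natAbs *
      ((((j : ℤ)).natAbs : ℝ) * r ^ ((j : ℤ)).natAbs) = r ^ n * (n * (n - 1) / 2) := by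
      have : ∀ j ∈ Finset.range n, r ^ ((n : ℤ) - (j : ℤ)).natAbs *
          ((((j : ℤ)).natAbs : ℝ) * r ^ ((j : ℤ)).natAbs) = r ^ n * (j : ℝ) := by
        intro j hj
        have hj' := Finset.mem_range.1 hj
        have e1 : ((n : ℤ) - (j : ℤ)).natAbs = n - j := by omega
        rw [e1, Int.natAbs_natCast]
        have : r ^ n = r ^ (n - j) * r ^ j := by rw [← pow_add]; congr 1; omega
        rw [this]; ring
      rw [Finset.sum_congr rfl this, ← Finset.mul_sum]
      congr 1
      exact bo_gauss n
    rw [hs]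
    have h3 := ((h0.mul_left (n : ℝ)).add h1).mul_left (r ^ n)
    refine (h3.congr_val_bo ?_).congr_fun_bo ?_
    · ring
    · intro j
      have e1 : ((n : ℤ) - ((j + n : ℕ) : ℤ)).natAbs = j := by omega
      rw [e1, Int.natAbs_natCast]
      push_cast
      ring
  refine (HasSum.of_nat_of_neg_add_one (f := fun m : ℤ =>
    r ^ ((n : ℤ) - m).natAbs * ((m.natAbs : ℝ) * r ^ m.natAbs)) hpos hneg).congr_val_bo ?_
  ring

lemma bo_aux (r : ℝ) (hr0 : 0 < r) (hr1 : r < 1) (n : ℤ) :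
    HasSum (fun m : ℤ => r ^ (n - m).natAbs * ((m.natAbs : ℝ) * r ^ m.natAbs))
      (r ^ n.natAbs * (2 * (r ^ 2 / (1 - r ^ 2) ^ 2) + n.natAbs * (n.natAbs - 1) / 2
        + n.natAbs * (1 - r ^ 2)⁻¹)) := by
  have h := bo_aux_nat r hr0 hr1 n.natAbs
  rcases Int.natAbs_eq n with e | e
  · rwa [← e] at h
  · have e' : (n.natAbs : ℤ) = -n := by omega
    rw [e'] at h
    rw [← (Equiv.neg ℤ).hasSum_iff] at h
    convert h using 1
    funext m
    simp only [Function.comp, Equiv.neg_apply, Int.natAbs_neg]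
    congr 2
    omega

/-- rescaled real coefficients -/
noncomputable def boU (N : ℕ) (r : ℝ) (m : ℤ) : ℝ :=
  if m = 0 then N * ((1 - 3 * r ^ 2) / (1 - r ^ 2)) else 2 * N * r ^ m.natAbs

/-- rescaled real coefficients -/
noncomputable def boW (N : ℕ) (r : ℝ) (m : ℤ) : ℝ :=
  if m = 0 then -4 * (N : ℝ) * r / (1 - r ^ 2) ^ 2
  else 2 * N * (m.natAbs : ℝ) * r ^ (m.natAbs - 1)

lemma bo_abs_div (N : ℕ) (hN : 1 ≤ N) (m : ℤ) : |(N : ℤ) * m| / (N : ℤ) = (m.natAbs : ℤ) := by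
  have : (N : ℤ) ≠ 0 := by omega
  rw [abs_mul, Nat.abs_cast, Int.mul_ediv_cancel_left _ this, Int.abs_eq_natAbs]

lemma uhat_eq (N : ℕ) (hN : 1 ≤ N) (r : ℝ) (hr0 : 0 < r) (m : ℤ) :
    uhat N (r : ℂ) ((N : ℤ) * m) = ((boU N r m : ℝ) : ℂ) := by
  have hN0 : (N : ℤ) ≠ 0 := by omega
  unfold uhat boU
  by_cases hm : m = 0
  · simp [hm]
  · have h1 : (N : ℤ) * m ≠ 0 := mul_ne_zero hN0 hm
    rw [if_neg h1, if_neg hm, if_pos (dvd_mul_right _ _), bo_abs_div N hN]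
    rw [Int.mul_ediv_cancel_left _ hN0, Complex.conj_ofReal, Int.toNat_natCast]
    split_ifs with h
    · have : 0 < m := by
        by_contra h'
        have : (N : ℤ) * m ≤ 0 := mul_nonpos_of_nonneg_of_nonpos (by omega) (by omega)
        omega
      have e : m.toNat = m.natAbs := by omega
      rw [e]; push_cast; rfl
    · push_cast; rfl

lemma wamp_eq (N : ℕ) (hN : 1 ≤ N) (r : ℝ) (m : ℤ) :
    wamp N r ((N : ℤ) * m) = boW N r m := by
  have hN0 : (N : ℤ) ≠ 0 := by omega
  unfold wamp boW
  by_cases hm : m = 0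
  · simp [hm]
  · have h1 : (N : ℤ) * m ≠ 0 := mul_ne_zero hN0 hm
    rw [if_neg h1, if_neg hm, if_pos (dvd_mul_right _ _), bo_abs_div N hN]
    have e : ((m.natAbs : ℤ) - 1).toNat = m.natAbs - 1 := by omega
    rw [e, abs_mul, Nat.abs_cast, Int.abs_eq_natAbs]
    simp only [Int.cast_mul, Int.cast_natCast]
    ring

lemma bo_conv (N : ℕ) (r : ℝ) (hr0 : 0 < r) (hr1 : r < 1) (n : ℤ) :
    ∃ S : ℝ, HasSum (fun m : ℤ => boU N r (n - m) * boW N r m) S ∧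
      (n ≠ 0 → S = N * n.natAbs * boW N r n) := by
  have hq : 1 - r ^ 2 ≠ 0 := by nlinarith
  have h := (((bo_aux r hr0 hr1 n).mul_left (4 * (N : ℝ) ^ 2 / r)).add
    (hasSum_ite_eq (0 : ℤ)
      (2 * N * r ^ n.natAbs * (-4 * (N : ℝ) * r / (1 - r ^ 2) ^ 2)))).add
    (hasSum_ite_eq n (N * (-(1 + r ^ 2) / (1 - r ^ 2)) * boW N r n))
  refine ⟨_, h.congr_fun_bo ?_, ?_⟩
  · intro m
    have hW : boW N r m = 2 * N / r * ((m.natAbs : ℝ) * r ^ m.natAbs)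
        + if m = 0 then (-4 * (N : ℝ) * r / (1 - r ^ 2) ^ 2) else 0 := by
      unfold boW
      split_ifs with hm
      · simp [hm]
      · obtain ⟨j, hj⟩ : ∃ j, m.natAbs = j + 1 := ⟨m.natAbs - 1, by omega⟩
        rw [hj, Nat.add_sub_cancel, pow_succ]
        field_simp
        ring
    have hU : boU N r (n - m) = 2 * N * r ^ (n - m).natAbs
        + if m = n then N * (-(1 + r ^ 2) / (1 - r ^ 2)) else 0 := by
      unfold boU
      by_cases hm : m = n
      · subst hm
        simp
        field_simp
        ring
      · have : n - m ≠ 0 := by omega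
        simp [hm, this]
    rw [hU, add_mul]
    congr 1
    · rw [hW]
      by_cases hm : m = 0
      · simp [hm]
      · simp only [hm, if_false]; ring
    · split_ifs with hm
      · rw [hm]
      · simp
  · intro hn
    unfold boW
    rw [if_neg hn]
    obtain ⟨j, hj⟩ : ∃ j, n.natAbs = j + 1 := ⟨n.natAbs - 1, by omega⟩
    rw [hj, Nat.add_sub_cancel, pow_succ]
    push_cast
    field_simp
    ring

/-- The derivative of the stationary solution with respect to the amplitude
parameter `|β|` lies in the kernel of the linearized Benjamin–Ono operator `BA`;
hence the zero eigenvalue has geometric multiplicity at least two. -/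
theorem benjamin_ono_kernel_amplitude (N : ℕ) (hN : 1 ≤ N) (r : ℝ)
    (hr0 : 0 < r) (hr1 : r < 1) (k : ℤ) :
    Summable (fun l : ℤ => ‖uhat N (r : ℂ) (k - l) * ((wamp N r l : ℝ) : ℂ)‖) ∧
    (k : ℂ) * (((|k| : ℤ) : ℂ) * ((wamp N r k : ℝ) : ℂ)
        - ∑' l : ℤ, uhat N (r : ℂ) (k - l) * ((wamp N r l : ℝ) : ℂ)) = 0 := by
  have hN0 : (N : ℤ) ≠ 0 := by omega
  by_cases hk : (N : ℤ) ∣ k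
  · obtain ⟨n, rfl⟩ := hk
    obtain ⟨S, hS, hS'⟩ := bo_conv N r hr0 hr1 n
    have hinj : Function.Injective (fun m : ℤ => (N : ℤ) * m) :=
      fun a b hab => mul_left_cancel₀ hN0 hab
    have hsupp : ∀ l ∉ Set.range (fun m : ℤ => (N : ℤ) * m), wamp N r l = 0 := by
      intro l hl
      have h1 : ¬ (N : ℤ) ∣ l := fun ⟨c, hc⟩ => hl ⟨c, hc.symm⟩
      have h2 : l ≠ 0 := fun h => h1 (h ▸ dvd_zero _)
      simp [wamp, h1, h2]
    have hcomp : ((fun l : ℤ => uhat N (r : ℂ) ((N : ℤ) * n - l) * ((wamp N r l : ℝ) : ℂ)) ∘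
        (fun m : ℤ => (N : ℤ) * m)) =
        fun m : ℤ => ((boU N r (n - m) * boW N r m : ℝ) : ℂ) := by
      funext m
      simp only [Function.comp]
      rw [← mul_sub, uhat_eq N hN r hr0, wamp_eq N hN r]
      push_cast
      rfl
    have hC : HasSum (fun l : ℤ => uhat N (r : ℂ) ((N : ℤ) * n - l) * ((wamp N r l : ℝ) : ℂ))
        (S : ℂ) := by
      rw [← hinj.hasSum_iff (fun l hl => by rw [hsupp l hl]; simp), hcomp]
      exact_mod_cast hS
    refine ⟨hC.summable.norm, ?_⟩
    rw [hC.tsum_eq]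
    by_cases hn : n = 0
    · simp [hn]
    · rw [hS' hn, wamp_eq N hN r, abs_mul, Nat.abs_cast, Int.abs_eq_natAbs]
      simp only [Int.cast_mul, Int.cast_natCast, Complex.ofReal_mul, Complex.ofReal_natCast]
      ring
  · have hz : ∀ l : ℤ, uhat N (r : ℂ) (k - l) * ((wamp N r l : ℝ) : ℂ) = 0 := by
      intro l
      by_cases hl : (N : ℤ) ∣ l
      · have h1 : ¬ (N : ℤ) ∣ (k - l) := fun h => hk (by simpa using dvd_add h hl)
        have h2 : k - l ≠ 0 := fun h => h1 (h ▸ dvd_zero _)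
        simp only [uhat, if_neg h1, if_neg h2, zero_mul]
      · have h2 : l ≠ 0 := fun h => hl (h ▸ dvd_zero _)
        simp [wamp, hl, h2]
    have hk0 : k ≠ 0 := fun h => hk (h ▸ dvd_zero _)
    simp only [hz]
    simp [wamp, hk, hk0]
end

section
/- Let N ≥ 1 and ν be integers, T > 0 a real number, and β ∈ [0,1). Set α = (1−3β²)/(1−β²) and define c̃ : ℤ×ℤ → ℝ by c̃(0,0) = N·α + 2πν/(NT), c̃(k,j) = 2N·β^(|k|/N) if k is a nonzero multiple of N and j = νk/N, and c̃(k,j) = 0 otherwise. Then for every integer k > 0 and every j ∈ ℤ, the double series Σ_{(l,p)∈ℤ×ℤ} c̃(l,p)·c̃(k−l, j−p) converges absolutely and (k/2)·Σ_{(l,p)∈ℤ×ℤ} c̃(l,p)·c̃(k−l, j−p) = (k² + (2π/T)·j)·c̃(k,j). (These coefficients are those of an N-hump traveling wave of the Benjamin–Ono equation with period T and speed index ν.) -/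
/-- Lattice coefficients of an `N`-hump traveling wave of the Benjamin–Ono
equation with period `T`, speed index `ν` and decay parameter `β`. -/
noncomputable def ctilde (N : ℕ) (ν : ℤ) (T β : ℝ) (k j : ℤ) : ℝ :=
  if k = 0 ∧ j = 0 then (N : ℝ) * ((1 - 3 * β ^ 2) / (1 - β ^ 2)) + 2 * Real.pi * (ν : ℝ) / ((N : ℝ) * T)
  else if (N : ℤ) ∣ k ∧ j * (N : ℤ) = ν * k then 2 * (N : ℝ) * β ^ ((|k| / (N : ℤ)).toNat)
  else 0

lemma bo_geom (β : ℝ) (hβ0 : 0 ≤ β) (hβ1 : β < 1) (n : ℕ) :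
    HasSum (fun m : ℤ => β ^ (m.natAbs + ((n : ℤ) - m).natAbs))
      ((n * β ^ n + β ^ n * (1 - β ^ 2)⁻¹) + β ^ (n + 2) * (1 - β ^ 2)⁻¹) := by
  have hg : HasSum (fun m : ℕ => (β ^ 2) ^ m) (1 - β ^ 2)⁻¹ :=
    hasSum_geometric_of_lt_one (by positivity) (by nlinarith)
  apply HasSum.of_nat_of_neg_add_one
  · rw [← hasSum_nat_add_iff' n]
    have h1 : ∑ i ∈ Finset.range n, β ^ ((i : ℤ).natAbs + ((n : ℤ) - (i : ℤ)).natAbs)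
        = n * β ^ n := by
      rw [Finset.sum_congr rfl (g := fun _ => β ^ n)]
      · simp
      · intro i hi
        have := Finset.mem_range.1 hi
        congr 1
        omega
    rw [h1, add_sub_cancel_left]
    convert hg.mul_left (β ^ n) using 1
    · rfl
    funext m
    rw [← pow_mul, ← pow_add]
    congr 1
    omega
  · convert hg.mul_left (β ^ (n + 2)) using 1
    · rfl
    funext m
    rw [← pow_mul, ← pow_add]
    congr 1
    omega

lemma ctilde_on (N : ℕ) (hN : 1 ≤ N) (ν : ℤ) (T β : ℝ) (m : ℤ) :
    ctilde N ν T β (m * N) (ν * m) = 2 * (N : ℝ) * β ^ m.natAbs +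
      if m = 0 then ((N : ℝ) * ((1 - 3 * β ^ 2) / (1 - β ^ 2))
        + 2 * Real.pi * (ν : ℝ) / ((N : ℝ) * T) - 2 * N) else 0 := by
  have hN' : (N : ℤ) ≠ 0 := by omega
  unfold ctilde
  by_cases hm : m = 0
  · subst hm; simp
  · have h1 : ¬ (m * (N : ℤ) = 0 ∧ ν * m = 0) := by
      rintro ⟨h, -⟩
      exact (mul_ne_zero hm hN') h
    rw [if_neg h1, if_pos ⟨Dvd.intro_left m rfl, by ring⟩, if_neg hm, add_zero]
    congr 2
    rw [abs_mul, Nat.abs_cast, Int.mul_ediv_cancel _ hN', Int.abs_eq_natAbs, Int.toNat_natCast]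

lemma ctilde_off (N : ℕ) (hN : 1 ≤ N) (ν : ℤ) (T β : ℝ) (k j : ℤ)
    (h : ¬ ∃ m : ℤ, k = m * N ∧ j = ν * m) : ctilde N ν T β k j = 0 := by
  have hN' : (N : ℤ) ≠ 0 := by omega
  unfold ctilde
  rw [if_neg, if_neg]
  · rintro ⟨⟨m, hm⟩, h2⟩
    refine h ⟨m, by rw [hm]; ring, ?_⟩
    apply mul_right_cancel₀ hN'
    rw [h2, hm]; ring
  · rintro ⟨h1, h2⟩
    exact h ⟨0, by simp [h1], by simp [h2]⟩

lemma bo_hasSum (N : ℕ) (hN : 1 ≤ N) (ν : ℤ)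
    (T : ℝ) (hT : 0 < T) (β : ℝ) (hβ0 : 0 ≤ β) (hβ1 : β < 1) (n : ℕ) (hn : 0 < n) :
    HasSum (fun p : ℤ × ℤ => ctilde N ν T β p.1 p.2 *
        ctilde N ν T β ((n : ℤ) * N - p.1) (ν * n - p.2))
      (4 * N * β ^ n * (N * n + 2 * Real.pi * ν / (N * T))) := by
  have hN' : (N : ℤ) ≠ 0 := by omega
  have hNr : (N : ℝ) ≠ 0 := by positivity
  have hb : 1 - β ^ 2 ≠ 0 := by nlinarith
  let g : ℤ → ℤ × ℤ := fun m => (m * N, ν * m)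
  have hg : Function.Injective g := by
    intro a b hab
    exact mul_right_cancel₀ hN' (congrArg Prod.fst hab)
  rw [← hg.hasSum_iff]
  · set C : ℝ := (N : ℝ) * ((1 - 3 * β ^ 2) / (1 - β ^ 2))
        + 2 * Real.pi * (ν : ℝ) / ((N : ℝ) * T) - 2 * N with hC
    have h0 := hasSum_ite_eq (0 : ℤ) (C * (2 * N * β ^ n))
    have h1 := hasSum_ite_eq (n : ℤ) (C * (2 * N * β ^ n))
    have h2 := (bo_geom β hβ0 hβ1 n).mul_left (4 * (N : ℝ) ^ 2)
    convert (h2.add h0).add h1 using 1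
    · rfl
    · funext m
      have e1 : (n : ℤ) * N - m * N = ((n : ℤ) - m) * N := by ring
      have e2 : ν * (n : ℤ) - ν * m = ν * ((n : ℤ) - m) := by ring
      simp only [Function.comp, g]
      rw [e1, e2, ctilde_on N hN, ctilde_on N hN, ← hC, pow_add]
      by_cases hm0 : m = 0
      · subst hm0
        have : (n : ℤ) ≠ 0 := by omega
        have h3 : (0 : ℤ) ≠ n := by omega
        simp [hn.ne']
        rw [if_neg (by omega)]
        ring
      · by_cases hmn : m = n
        · subst hmn
          simp [hn.ne']
          ring
        · have : (n : ℤ) - m ≠ 0 := by omega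
          simp [hm0, hmn, this]
          ring
    · rw [hC]
      field_simp
      ring
  · rintro ⟨l, p⟩ hp
    rw [ctilde_off N hN ν T β l p, zero_mul]
    rintro ⟨m, h1, h2⟩
    exact hp ⟨m, by simp [g, h1, h2]⟩

/-- The lattice coefficients of an `N`-hump traveling wave satisfy the lattice
form of the Benjamin–Ono equation:
`(k/2)·Σ_{(l,p)} c̃(l,p)·c̃(k−l,j−p) = (k² + (2π/T)j)·c̃(k,j)` for `k > 0`. -/
theorem benjamin_ono_traveling_wave_lattice (N : ℕ) (hN : 1 ≤ N) (ν : ℤ)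
    (T : ℝ) (hT : 0 < T) (β : ℝ) (hβ0 : 0 ≤ β) (hβ1 : β < 1)
    (k : ℤ) (hk : 0 < k) (j : ℤ) :
    Summable (fun p : ℤ × ℤ => |ctilde N ν T β p.1 p.2 * ctilde N ν T β (k - p.1) (j - p.2)|) ∧
    ((k : ℝ) / 2) * ∑' p : ℤ × ℤ, ctilde N ν T β p.1 p.2 * ctilde N ν T β (k - p.1) (j - p.2)
      = ((k : ℝ) ^ 2 + (2 * Real.pi / T) * (j : ℝ)) * ctilde N ν T β k j := by
  have hN' : (N : ℤ) ≠ 0 := by omega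
  have hNr : (N : ℝ) ≠ 0 := by positivity
  by_cases h : ∃ m : ℤ, k = m * N ∧ j = ν * m
  · obtain ⟨m, rfl, rfl⟩ := h
    have hm : 0 < m := pos_of_mul_pos_left hk (by positivity)
    lift m to ℕ using hm.le
    have hn : 0 < m := by exact_mod_cast hm
    have H := bo_hasSum N hN ν T hT β hβ0 hβ1 m hn
    refine ⟨H.summable.abs, ?_⟩
    rw [H.tsum_eq, ctilde_on N hN, if_neg hm.ne']
    simp only [Int.natAbs_natCast]
    push_cast
    field_simp
    ring
  · have hz : ∀ p : ℤ × ℤ,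
        ctilde N ν T β p.1 p.2 * ctilde N ν T β (k - p.1) (j - p.2) = 0 := by
      intro p
      by_cases h1 : ∃ m : ℤ, p.1 = m * N ∧ p.2 = ν * m
      · rw [ctilde_off N hN ν T β (k - p.1), mul_zero]
        rintro ⟨b, hb1, hb2⟩
        obtain ⟨a, ha1, ha2⟩ := h1
        exact h ⟨a + b, by linarith, by linarith⟩
      · rw [ctilde_off N hN ν T β p.1 p.2 h1, zero_mul]
    rw [ctilde_off N hN ν T β k j h]
    simp only [hz]
    simp [summable_zero]
end

section
/- Let N > N' > 0 be integers, let A, B, C ∈ [0,1) be real numbers satisfying A ≥ BC, B ≥ CA and C ≥ AB, and let μ, σ ∈ ℂ with |μ| = |σ| = 1. Then every complex root z of the polynomial z^N + A·μ·z^(N−N') + B·σ·z^(N') + C·μ·σ satisfies |z| < 1. -/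
/-- Root-location result (Rouché argument of the appendix): if `A, B, C ∈ [0,1)`
satisfy `A ≥ BC`, `B ≥ CA`, `C ≥ AB`, and `|μ| = |σ| = 1`, then every root of
`z^N + Aμz^{N−N'} + Bσz^{N'} + Cμσ` lies in the open unit disk. -/
theorem roots_in_unit_disk (N N' : ℕ) (hN' : 0 < N') (hNN : N' < N)
    (A B C : ℝ) (hA0 : 0 ≤ A) (hA1 : A < 1) (hB0 : 0 ≤ B) (hB1 : B < 1)
    (hC0 : 0 ≤ C) (hC1 : C < 1)
    (hABC : B * C ≤ A) (hBCA : C * A ≤ B) (hCAB : A * B ≤ C)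
    (μ σ : ℂ) (hμ : ‖μ‖ = 1) (hσ : ‖σ‖ = 1) (z : ℂ)
    (hz : z ^ N + (A : ℂ) * μ * z ^ (N - N') + (B : ℂ) * σ * z ^ N' + (C : ℂ) * μ * σ = 0) :
    ‖z‖ < 1 := by
  by_contra hlt
  have hz1 : 1 ≤ ‖z‖ := not_lt.mp hlt
  have hμ0 : μ ≠ 0 := by
    intro h
    simp [h] at hμ
  have hsplit : z ^ N = z ^ N' * z ^ (N - N') := by
    rw [← pow_add]
    congr 1
    omega
  have hy1 : 1 ≤ ‖z ^ (N - N')‖ := by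
    rw [norm_pow]
    exact one_le_pow₀ hz1
  obtain ⟨x, hx⟩ : ∃ x : ℂ, z ^ N' = μ * x := ⟨z ^ N' / μ, by field_simp⟩
  have hx1 : 1 ≤ ‖x‖ := by
    have h : ‖z ^ N'‖ = ‖x‖ := by rw [hx, norm_mul, hμ, one_mul]
    rw [← h, norm_pow]
    exact one_le_pow₀ hz1
  rw [hsplit, hx] at hz
  generalize z ^ (N - N') = y at hz hy1
  have h0 : μ * (y * (x + A) + σ * (B * x + C)) = 0 := by linear_combination hz
  have h1 : y * (x + A) = -(σ * (B * x + C)) :=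
    eq_neg_of_add_eq_zero_left ((mul_eq_zero.mp h0).resolve_left hμ0)
  have h2 : ‖y‖ * ‖x + A‖ = ‖(B : ℂ) * x + C‖ := by
    rw [← norm_mul, h1, norm_neg, norm_mul, hσ, one_mul]
  have h3 : ‖x + A‖ ≤ ‖(B : ℂ) * x + C‖ := by
    rw [← h2]
    exact le_mul_of_one_le_left (norm_nonneg _) hy1
  have h4 : ‖x + A‖ ^ 2 ≤ ‖(B : ℂ) * x + C‖ ^ 2 := pow_le_pow_left₀ (norm_nonneg _) h3 2
  have hr : ‖x‖ ^ 2 = x.re * x.re + x.im * x.im := by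
    rw [Complex.sq_norm, Complex.normSq_apply]
  rw [Complex.sq_norm, Complex.sq_norm, Complex.normSq_apply, Complex.normSq_apply] at h4
  simp at h4
  have hre : -‖x‖ ≤ x.re := (abs_le.mp (Complex.abs_re_le_norm x)).1
  generalize ‖x‖ = r at *
  have f1 : 0 < r - A - B * r + C := by
    nlinarith [mul_pos (sub_pos.mpr hA1) (sub_pos.mpr hB1),
      mul_nonneg (sub_nonneg.mpr hB1.le) (sub_nonneg.mpr hx1)]
  have f2 : 0 < r - A + B * r - C := by
    nlinarith [mul_pos (sub_pos.mpr hA1) (sub_pos.mpr hC1),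
      mul_nonneg hB0 (sub_nonneg.mpr hx1)]
  have f3 : 0 ≤ (A - B * C) * (x.re + r) :=
    mul_nonneg (sub_nonneg.mpr hABC) (by linarith)
  have f4 := mul_pos f1 f2
  have e : (1 - B ^ 2) * (r ^ 2 - (x.re * x.re + x.im * x.im)) = 0 := by rw [hr]; ring
  nlinarith [f3, f4, e, h4]
end

section
/- With A, B, C, α₀, ω defined as in the coefficient formulas of Theorem 1 (with phases x₀ = t₀ = 0), the algebraic identity e₃ = 0 holds: ((N')² − 2NN' + N'·α₀ − ν'·ω)·B + ((N')² + 2NN' − N'·α₀ + ν'·ω)·A·C = 0. -/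
/-- `m = Nν' − N'ν` as a real number. -/
noncomputable def mval (N N' : ℕ) (ν ν' : ℤ) : ℝ :=
  (N : ℝ) * (ν' : ℝ) - (N' : ℝ) * (ν : ℝ)

/-- The coefficient `A` of Theorem 1 (phases `x₀ = t₀ = 0`). -/
noncomputable def coefA (N N' : ℕ) (ρ ρ' : ℝ) : ℝ :=
  Real.sqrt (((N : ℝ) - (N' : ℝ) + ρ + ρ') / ((N : ℝ) + ρ + ρ')) *
    Real.sqrt ((((N : ℝ) + ρ') * ρ') /
      ((N' : ℝ) * ((N : ℝ) - (N' : ℝ)) + ((N : ℝ) + ρ') * ρ'))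

/-- The coefficient `B` of Theorem 1 (phases `x₀ = t₀ = 0`). -/
noncomputable def coefB (N N' : ℕ) (ρ ρ' : ℝ) : ℝ :=
  Real.sqrt ((((N : ℝ) + ρ') * ρ') /
      ((N' : ℝ) * ((N : ℝ) - (N' : ℝ)) + ((N : ℝ) + ρ') * ρ')) *
    Real.sqrt (ρ / ((N : ℝ) - (N' : ℝ) + ρ))

/-- The coefficient `C` of Theorem 1 (phases `x₀ = t₀ = 0`). -/
noncomputable def coefC (N N' : ℕ) (ρ ρ' : ℝ) : ℝ :=
  Real.sqrt (ρ / ((N : ℝ) - (N' : ℝ) + ρ)) *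
    Real.sqrt (((N : ℝ) - (N' : ℝ) + ρ + ρ') / ((N : ℝ) + ρ + ρ'))

/-- The mean `α₀` of Theorem 1. -/
noncomputable def alphaZero (N N' : ℕ) (ν ν' : ℤ) (ρ ρ' : ℝ) : ℝ :=
  ((N : ℝ) ^ 2 * (ν' : ℝ) - (N' : ℝ) ^ 2 * (ν : ℝ)) / mval N N' ν ν' - 2 * ρ -
    (2 * (N' : ℝ) * ((ν' : ℝ) - (ν : ℝ)) / mval N N' ν ν') * ρ'

/-- The temporal frequency `ω = 2π/T` of Theorem 1. -/
noncomputable def omegaVal (N N' : ℕ) (ν ν' : ℤ) (ρ' : ℝ) : ℝ :=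
  (N' : ℝ) * ((N : ℝ) - (N' : ℝ)) * ((N : ℝ) + 2 * ρ') / mval N N' ν ν'

/-- The algebraic identity `e₃ = 0` of the proof of Theorem 1. -/
theorem identity_e3 (N N' : ℕ) (hN' : 0 < N') (hNN : N' < N) (ν ν' : ℤ)
    (hm : 0 < (N : ℤ) * ν' - (N' : ℤ) * ν) (ρ ρ' : ℝ) (hρ : 0 ≤ ρ) (hρ' : 0 ≤ ρ') :
    ((N' : ℝ) ^ 2 - 2 * (N : ℝ) * (N' : ℝ) + (N' : ℝ) * alphaZero N N' ν ν' ρ ρ'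
        - (ν' : ℝ) * omegaVal N N' ν ν' ρ') * coefB N N' ρ ρ' +
      ((N' : ℝ) ^ 2 + 2 * (N : ℝ) * (N' : ℝ) - (N' : ℝ) * alphaZero N N' ν ν' ρ ρ'
        + (ν' : ℝ) * omegaVal N N' ν ν' ρ') * coefA N N' ρ ρ' * coefC N N' ρ ρ' = 0 := by
  have hm' : mval N N' ν ν' ≠ 0 := by
    have h : (0 : ℝ) < (N : ℝ) * ν' - (N' : ℝ) * ν := by exact_mod_cast hm
    exact ne_of_gt h
  have hN : (N' : ℝ) < N := by exact_mod_cast hNN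
  have hN0 : (0 : ℝ) < N' := by exact_mod_cast hN'
  have hK : 2 * (N : ℝ) * (N' : ℝ) - (N' : ℝ) * alphaZero N N' ν ν' ρ ρ'
      + (ν' : ℝ) * omegaVal N N' ν ν' ρ' = N' * (2 * N - N' + 2 * ρ + 2 * ρ') := by
    unfold alphaZero omegaVal
    field_simp
    unfold mval
    ring
  have hd : (0 : ℝ) < (N : ℝ) + ρ + ρ' := by linarith
  have hs : 0 ≤ ((N : ℝ) - (N' : ℝ) + ρ + ρ') / ((N : ℝ) + ρ + ρ') :=
    div_nonneg (by linarith) hd.le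
  have hAC : coefA N N' ρ ρ' * coefC N N' ρ ρ' =
      ((N : ℝ) - (N' : ℝ) + ρ + ρ') / ((N : ℝ) + ρ + ρ') * coefB N N' ρ ρ' := by
    unfold coefA coefB coefC
    have h := Real.mul_self_sqrt hs
    linear_combination (Real.sqrt ((((N : ℝ) + ρ') * ρ') /
      ((N' : ℝ) * ((N : ℝ) - (N' : ℝ)) + ((N : ℝ) + ρ') * ρ')) *
      Real.sqrt (ρ / ((N : ℝ) - (N' : ℝ) + ρ))) * h
  have h1 : (N' : ℝ) ^ 2 - 2 * (N : ℝ) * (N' : ℝ) + (N' : ℝ) * alphaZero N N' ν ν' ρ ρ'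
      - (ν' : ℝ) * omegaVal N N' ν ν' ρ' = -(2 * N' * ((N : ℝ) - N' + ρ + ρ')) := by
    linear_combination -hK
  have h2 : (N' : ℝ) ^ 2 + 2 * (N : ℝ) * (N' : ℝ) - (N' : ℝ) * alphaZero N N' ν ν' ρ ρ'
      + (ν' : ℝ) * omegaVal N N' ν ν' ρ' = 2 * N' * ((N : ℝ) + ρ + ρ') := by
    linear_combination hK
  rw [h1, h2, mul_assoc (2 * (N' : ℝ) * _), hAC]
  field_simp
  ring
end

section
/- With A, B, C, α₀, ω defined as in the coefficient formulas of Theorem 1 (with phases x₀ = t₀ = 0), the algebraic identity e₄ = 0 holds: (3N² − 4NN' + (N')² − (N−N')·α₀ + (ν−ν')·ω)·B·C − (N² − (N')² − (N−N')·α₀ + (ν−ν')·ω)·A = 0. -/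
/-- The algebraic identity `e₄ = 0` of the proof of Theorem 1. -/
theorem identity_e4 (N N' : ℕ) (hN' : 0 < N') (hNN : N' < N) (ν ν' : ℤ)
    (hm : 0 < (N : ℤ) * ν' - (N' : ℤ) * ν) (ρ ρ' : ℝ) (hρ : 0 ≤ ρ) (hρ' : 0 ≤ ρ') :
    (3 * (N : ℝ) ^ 2 - 4 * (N : ℝ) * (N' : ℝ) + (N' : ℝ) ^ 2
        - ((N : ℝ) - (N' : ℝ)) * alphaZero N N' ν ν' ρ ρ'
        + ((ν : ℝ) - (ν' : ℝ)) * omegaVal N N' ν ν' ρ') * coefB N N' ρ ρ' * coefC N N' ρ ρ' -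
      ((N : ℝ) ^ 2 - (N' : ℝ) ^ 2 - ((N : ℝ) - (N' : ℝ)) * alphaZero N N' ν ν' ρ ρ'
        + ((ν : ℝ) - (ν' : ℝ)) * omegaVal N N' ν ν' ρ') * coefA N N' ρ ρ' = 0 := by
  have hm' : mval N N' ν ν' ≠ 0 := by
    unfold mval
    have h : (0 : ℝ) < (N : ℝ) * ν' - (N' : ℝ) * ν := by exact_mod_cast hm
    exact h.ne'
  have hD : (0 : ℝ) < (N : ℝ) - N' := by
    have : (N' : ℝ) < N := by exact_mod_cast hNN
    linarith
  have hE : (N : ℝ) ^ 2 - (N' : ℝ) ^ 2 - ((N : ℝ) - (N' : ℝ)) * alphaZero N N' ν ν' ρ ρ'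
        + ((ν : ℝ) - (ν' : ℝ)) * omegaVal N N' ν ν' ρ' = 2 * ((N : ℝ) - N') * ρ := by
    unfold alphaZero omegaVal
    field_simp
    unfold mval
    ring
  have hBC : coefB N N' ρ ρ' * coefC N N' ρ ρ'
      = coefA N N' ρ ρ' * (ρ / ((N : ℝ) - N' + ρ)) := by
    have h := Real.mul_self_sqrt (show 0 ≤ ρ / ((N : ℝ) - N' + ρ) by positivity)
    unfold coefA coefB coefC
    generalize Real.sqrt (ρ / ((N : ℝ) - N' + ρ)) = r at h ⊢
    rw [← h]
    ring
  have hE2 : 3 * (N : ℝ) ^ 2 - 4 * (N : ℝ) * (N' : ℝ) + (N' : ℝ) ^ 2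
        - ((N : ℝ) - (N' : ℝ)) * alphaZero N N' ν ν' ρ ρ'
        + ((ν : ℝ) - (ν' : ℝ)) * omegaVal N N' ν ν' ρ'
        = 2 * ((N : ℝ) - N') * ((N : ℝ) - N' + ρ) := by
    linear_combination hE
  have hne : (N : ℝ) - N' + ρ ≠ 0 := by positivity
  rw [hE, hE2, mul_assoc, hBC]
  field_simp
  ring
end

section
/- With A, B, C, α₀, ω defined as in the coefficient formulas of Theorem 1 (with phases x₀ = t₀ = 0), the algebraic identity e₅ = 0 holds: (N·α₀ − ν·ω − N²) + ((2N'−N)·α₀ + (ν−2ν')·ω + 3N² − 8NN' + 4(N')²)·B² + ((N−2N')·α₀ + 4(N')² − N² + (2ν'−ν)·ω)·A² + ((3N−α₀)·N + ν·ω)·C² = 0. -/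
/-- The algebraic identity `e₅ = 0` of the proof of Theorem 1. -/
theorem identity_e5 (N N' : ℕ) (hN' : 0 < N') (hNN : N' < N) (ν ν' : ℤ)
    (hm : 0 < (N : ℤ) * ν' - (N' : ℤ) * ν) (ρ ρ' : ℝ) (hρ : 0 ≤ ρ) (hρ' : 0 ≤ ρ') :
    ((N : ℝ) * alphaZero N N' ν ν' ρ ρ' - (ν : ℝ) * omegaVal N N' ν ν' ρ' - (N : ℝ) ^ 2) +
      ((2 * (N' : ℝ) - (N : ℝ)) * alphaZero N N' ν ν' ρ ρ'
        + ((ν : ℝ) - 2 * (ν' : ℝ)) * omegaVal N N' ν ν' ρ'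
        + 3 * (N : ℝ) ^ 2 - 8 * (N : ℝ) * (N' : ℝ) + 4 * (N' : ℝ) ^ 2) * coefB N N' ρ ρ' ^ 2 +
      (((N : ℝ) - 2 * (N' : ℝ)) * alphaZero N N' ν ν' ρ ρ'
        + 4 * (N' : ℝ) ^ 2 - (N : ℝ) ^ 2
        + (2 * (ν' : ℝ) - (ν : ℝ)) * omegaVal N N' ν ν' ρ') * coefA N N' ρ ρ' ^ 2 +
      ((3 * (N : ℝ) - alphaZero N N' ν ν' ρ ρ') * (N : ℝ)
        + (ν : ℝ) * omegaVal N N' ν ν' ρ') * coefC N N' ρ ρ' ^ 2 = 0 := by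
  have h1 : (0 : ℝ) < N' := by exact_mod_cast hN'
  have h2 : (0 : ℝ) < (N : ℝ) - N' := by
    have : (N' : ℝ) < N := by exact_mod_cast hNN
    linarith
  have hm' : (N : ℝ) * ν' - N' * ν ≠ 0 := by
    have : (0 : ℝ) < (N : ℝ) * ν' - N' * ν := by exact_mod_cast hm
    exact this.ne'
  have d1 : 0 < (N : ℝ) + ρ + ρ' := by linarith
  have d2 : 0 < (N : ℝ) - N' + ρ := by linarith
  have hN : 0 < (N : ℝ) + ρ' := by linarith
  have d3 : 0 < (N' : ℝ) * ((N : ℝ) - N') + ((N : ℝ) + ρ') * ρ' := by positivity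
  have n1 : 0 ≤ (N : ℝ) - N' + ρ + ρ' := by linarith
  have e1 : (N : ℝ) * alphaZero N N' ν ν' ρ ρ' - (ν : ℝ) * omegaVal N N' ν ν' ρ'
      = (N : ℝ) ^ 2 - 2 * N * ρ - 2 * N' * ρ' := by
    unfold alphaZero omegaVal mval
    field_simp
    ring
  have e2 : (N' : ℝ) * alphaZero N N' ν ν' ρ ρ' - (ν' : ℝ) * omegaVal N N' ν ν' ρ'
      = (N' : ℝ) ^ 2 - 2 * N' * ρ - 2 * N' * ρ' := by
    unfold alphaZero omegaVal mval
    field_simp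
    ring
  have hA : coefA N N' ρ ρ' ^ 2 = (((N : ℝ) - N' + ρ + ρ') / ((N : ℝ) + ρ + ρ')) *
      ((((N : ℝ) + ρ') * ρ') / ((N' : ℝ) * ((N : ℝ) - N') + ((N : ℝ) + ρ') * ρ')) := by
    unfold coefA
    rw [mul_pow, Real.sq_sqrt (by positivity), Real.sq_sqrt (by positivity)]
  have hB : coefB N N' ρ ρ' ^ 2 =
      ((((N : ℝ) + ρ') * ρ') / ((N' : ℝ) * ((N : ℝ) - N') + ((N : ℝ) + ρ') * ρ')) *
      (ρ / ((N : ℝ) - N' + ρ)) := by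
    unfold coefB
    rw [mul_pow, Real.sq_sqrt (by positivity), Real.sq_sqrt (by positivity)]
  have hC : coefC N N' ρ ρ' ^ 2 = (ρ / ((N : ℝ) - N' + ρ)) *
      (((N : ℝ) - N' + ρ + ρ') / ((N : ℝ) + ρ + ρ')) := by
    unfold coefC
    rw [mul_pow, Real.sq_sqrt (by positivity), Real.sq_sqrt (by positivity)]
  have key : (-2 * (N : ℝ) * ρ - 2 * N' * ρ')
      + (2 * (N : ℝ) ^ 2 - 8 * N * N' + 6 * (N' : ℝ) ^ 2 + 2 * ((N : ℝ) - 2 * N') * ρ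
        - 2 * N' * ρ') * coefB N N' ρ ρ' ^ 2
      + (2 * (N' : ℝ) ^ 2 - 2 * ((N : ℝ) - 2 * N') * ρ + 2 * N' * ρ') * coefA N N' ρ ρ' ^ 2
      + (2 * (N : ℝ) ^ 2 + 2 * N * ρ + 2 * N' * ρ') * coefC N N' ρ ρ' ^ 2 = 0 := by
    rw [hA, hB, hC]
    have := d1.ne'
    have := d2.ne'
    have := d3.ne'
    field_simp
    ring
  linear_combination key + (1 - coefB N N' ρ ρ' ^ 2 + coefA N N' ρ ρ' ^ 2
      - coefC N N' ρ ρ' ^ 2) * e1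
    + (2 * coefB N N' ρ ρ' ^ 2 - 2 * coefA N N' ρ ρ' ^ 2) * e2
end

section
/- Let N > N' > 0 and ν, ν' be integers with m := Nν' − N'ν > 0, let ρ, ρ' ≥ 0, and let A, B, C, α₀, ω be as in the coefficient formulas of Theorem 1 (with phases x₀ = t₀ = 0). Set γ = (3N − α₀)·N − ν·ω. For z, λ ∈ ℂ with |z| = |λ| = 1, define P₀₀ = z^N + Aλ^{ν'}z^{N−N'} + Bλ^{ν−ν'}z^{N'} + Cλ^{ν}, P₁₀ = N·z^N + A(N−N')λ^{ν'}z^{N−N'} + B·N'·λ^{ν−ν'}z^{N'}, P₂₀ = N²·z^N + A(N−N')²λ^{ν'}z^{N−N'} + B(N')²λ^{ν−ν'}z^{N'}, and P₀₁ = Aν'λ^{ν'}z^{N−N'} + B(ν−ν')λ^{ν−ν'}z^{N'} + Cνλ^{ν} (the values of (z∂_z)^j(λ∂_λ)^k P at (z,λ)). Then, with Q = P₂₀ + ω·P₀₁ + (α₀−4N)·P₁₀, one has γ·P₀₀·conj(P₀₀) + conj(P₀₀)·Q + P₀₀·conj(Q) + 2·P₁₀·conj(P₁₀) = 0. (This is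 the algebraic identity equivalent to the statement that the function u of Theorem 1 satisfies the Benjamin–Ono equation u_t = Hu_xx − uu_x.) -/
open Complex


/-- Weight of the pair of monomials with exponents `(n₁,k₁)`, `(n₂,k₂)`. -/
noncomputable def wt (n v al om n₁ k₁ n₂ k₂ : ℝ) : ℝ :=
  ((3 * n - al) * n - v * om) + (n₁ ^ 2 + om * k₁ + (al - 4 * n) * n₁)
    + (n₂ ^ 2 + om * k₂ + (al - 4 * n) * n₂) + 2 * n₁ * n₂

lemma weights (n p v v' r r' al om : ℝ) (hp : 0 < p) (hd : p < n) (hm : n * v' - p * v ≠ 0)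
    (hr : 0 ≤ r) (hr' : 0 ≤ r')
    (hal : al = (n ^ 2 * v' - p ^ 2 * v) / (n * v' - p * v) - 2 * r
      - (2 * p * (v' - v) / (n * v' - p * v)) * r')
    (hom : om = p * (n - p) * (n + 2 * r') / (n * v' - p * v))
    (a b c : ℝ) (ha : a ^ 2 = (n - p + r + r') / (n + r + r'))
    (hb : b ^ 2 = ((n + r') * r') / (p * (n - p) + (n + r') * r'))
    (hc : c ^ 2 = r / (n - p + r)) :
    wt n v al om n 0 (n - p) v' + c ^ 2 * wt n v al om p (v - v') 0 v = 0 ∧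
    wt n v al om n 0 p (v - v') + a ^ 2 * wt n v al om (n - p) v' 0 v = 0 ∧
    wt n v al om n 0 n 0 + a ^ 2 * b ^ 2 * wt n v al om (n - p) v' (n - p) v'
      + b ^ 2 * c ^ 2 * wt n v al om p (v - v') p (v - v')
      + c ^ 2 * a ^ 2 * wt n v al om 0 v 0 v = 0 := by
  have hd' : 0 < n - p := by linarith
  have h1 : n + r + r' ≠ 0 := by
    have hn : 0 < n := by linarith
    positivity
  have h2 : p * (n - p) + (n + r') * r' ≠ 0 := by
    have hn : 0 < n := by linarith
    positivity
  have h3 : n - p + r ≠ 0 := by positivity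
  have h4 : p * (n - p) + r' * (n + r') ≠ 0 := by rwa [mul_comm r']
  rw [ha, hb, hc, hal, hom]
  unfold wt
  refine ⟨?_, ?_, ?_⟩
  · field_simp
    ring
  · field_simp
    ring
  · field_simp
    ring

/-- The combined algebraic identity (equation (38) of the paper) satisfied by the
values `P_{jk} = (z∂_z)^j(λ∂_λ)^k P(z,λ)` on the torus `|z| = |λ| = 1`, which is
equivalent to the statement that the function `u` of Theorem 1 satisfies the
Benjamin–Ono equation `u_t = Hu_xx − uu_x`. -/
theorem benjamin_ono_lattice_identity (N N' : ℕ) (hN' : 0 < N') (hNN : N' < N)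
    (ν ν' : ℤ) (hm : 0 < (N : ℤ) * ν' - (N' : ℤ) * ν) (ρ ρ' : ℝ)
    (hρ : 0 ≤ ρ) (hρ' : 0 ≤ ρ') (z lam : ℂ) (hz : ‖z‖ = 1) (hlam : ‖lam‖ = 1) :
    let A : ℂ := (coefA N N' ρ ρ' : ℝ)
    let B : ℂ := (coefB N N' ρ ρ' : ℝ)
    let C : ℂ := (coefC N N' ρ ρ' : ℝ)
    let α₀ : ℝ := alphaZero N N' ν ν' ρ ρ'
    let ω : ℝ := omegaVal N N' ν ν' ρ'
    let γ : ℝ := (3 * (N : ℝ) - α₀) * (N : ℝ) - (ν : ℝ) * ω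
    let P₀₀ : ℂ := z ^ N + A * lam ^ ν' * z ^ (N - N') + B * lam ^ (ν - ν') * z ^ N'
      + C * lam ^ ν
    let P₁₀ : ℂ := (N : ℂ) * z ^ N + A * ((N : ℂ) - (N' : ℂ)) * lam ^ ν' * z ^ (N - N')
      + B * (N' : ℂ) * lam ^ (ν - ν') * z ^ N'
    let P₂₀ : ℂ := (N : ℂ) ^ 2 * z ^ N
      + A * ((N : ℂ) - (N' : ℂ)) ^ 2 * lam ^ ν' * z ^ (N - N')
      + B * (N' : ℂ) ^ 2 * lam ^ (ν - ν') * z ^ N'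
    let P₀₁ : ℂ := A * (ν' : ℂ) * lam ^ ν' * z ^ (N - N')
      + B * ((ν : ℂ) - (ν' : ℂ)) * lam ^ (ν - ν') * z ^ N' + C * (ν : ℂ) * lam ^ ν
    let Q : ℂ := P₂₀ + (ω : ℂ) * P₀₁ + ((α₀ : ℂ) - 4 * (N : ℂ)) * P₁₀
    (γ : ℂ) * P₀₀ * (starRingEnd ℂ P₀₀) + (starRingEnd ℂ P₀₀) * Q
      + P₀₀ * (starRingEnd ℂ Q) + 2 * P₁₀ * (starRingEnd ℂ P₁₀) = 0 := by
  intro A B C α₀ ω γ P₀₀ P₁₀ P₂₀ P₀₁ Q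
  have hz0 : z ≠ 0 := by
    rintro rfl
    simp at hz
  have hl0 : lam ≠ 0 := by
    rintro rfl
    simp at hlam
  have hmR : (0 : ℝ) < (N : ℝ) * ν' - N' * ν := by exact_mod_cast hm
  have hpR : (0 : ℝ) < N' := by exact_mod_cast hN'
  have hnR : (N' : ℝ) < N := by exact_mod_cast hNN
  have hdR : (0 : ℝ) < (N : ℝ) - N' := by linarith
  have hn0 : (0 : ℝ) < N := by linarith
  obtain ⟨a, ha⟩ : ∃ a, a = Real.sqrt (((N : ℝ) - (N' : ℝ) + ρ + ρ') / ((N : ℝ) + ρ + ρ')) :=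
    ⟨_, rfl⟩
  obtain ⟨b, hb⟩ : ∃ b, b = Real.sqrt ((((N : ℝ) + ρ') * ρ') /
      ((N' : ℝ) * ((N : ℝ) - (N' : ℝ)) + ((N : ℝ) + ρ') * ρ')) := ⟨_, rfl⟩
  obtain ⟨c, hc⟩ : ∃ c, c = Real.sqrt (ρ / ((N : ℝ) - (N' : ℝ) + ρ)) := ⟨_, rfl⟩
  have hA : A = (a : ℂ) * b := by
    simp only [A, coefA, ← ha, ← hb]
    push_cast
    rfl
  have hB : B = (b : ℂ) * c := by
    simp only [B, coefB, ← hb, ← hc]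
    push_cast
    rfl
  have hC : C = (c : ℂ) * a := by
    simp only [C, coefC, ← hc, ← ha]
    push_cast
    rfl
  obtain ⟨w1, w2, w3⟩ := weights N N' ν ν' ρ ρ' α₀ ω hpR hnR hmR.ne' hρ hρ' rfl rfl a b c
    (by rw [ha, Real.sq_sqrt (by positivity)]) (by rw [hb, Real.sq_sqrt (by positivity)])
    (by rw [hc, Real.sq_sqrt (by positivity)])
  have W1 := congrArg (fun x : ℝ => (x : ℂ)) w1
  have W2 := congrArg (fun x : ℝ => (x : ℂ)) w2
  have W3 := congrArg (fun x : ℝ => (x : ℂ)) w3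
  simp only [wt] at W1 W2 W3
  push_cast at W1 W2 W3
  have unit : ∀ w : ℂ, ‖w‖ = 1 → w * starRingEnd ℂ w = 1 := by
    intro w hw
    rw [Complex.mul_conj, Complex.normSq_eq_norm_sq, hw]
    norm_num
  obtain ⟨x, hx⟩ : ∃ x, x = z ^ N' := ⟨_, rfl⟩
  obtain ⟨y, hy⟩ : ∃ y, y = z ^ (N - N') := ⟨_, rfl⟩
  obtain ⟨l, hl⟩ : ∃ l, l = lam ^ ν' := ⟨_, rfl⟩
  obtain ⟨k, hk⟩ : ∃ k, k = lam ^ (ν - ν') := ⟨_, rfl⟩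
  have hxy : z ^ N = x * y := by
    rw [hx, hy, ← pow_add]
    congr 1
    omega
  have hlk : lam ^ ν = l * k := by
    rw [hl, hk, ← zpow_add₀ hl0]
    congr 1
    ring
  have ux := unit x (by rw [hx, norm_pow, hz, one_pow])
  have uy := unit y (by rw [hy, norm_pow, hz, one_pow])
  have ul := unit l (by rw [hl, norm_zpow, hlam, one_zpow])
  have uk := unit k (by rw [hk, norm_zpow, hlam, one_zpow])
  have hγ : (γ : ℂ) = (3 * (N : ℂ) - α₀) * N - ν * ω := by
    simp only [γ]
    push_cast
    rfl
  simp only [Q, P₂₀, P₀₁, P₁₀, P₀₀, hγ, hxy, hlk, ← hx, ← hy, ← hl, ← hk, hA, hB, hC]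
  simp only [map_add, map_mul, map_sub, map_pow, Complex.conj_ofReal, Complex.conj_natCast,
    map_intCast, map_ofNat]
  clear_value α₀ ω
  generalize starRingEnd ℂ x = x' at *
  generalize starRingEnd ℂ y = y' at *
  generalize starRingEnd ℂ l = l' at *
  generalize starRingEnd ℂ k = k' at *
  have E1 : (x * y) * (x' * y') = 1 := by linear_combination y * y' * ux + uy
  have E2 : (l * y) * (l' * y') = 1 := by linear_combination y * y' * ul + uy
  have E3 : (k * x) * (k' * x') = 1 := by linear_combination x * x' * uk + ux
  have E4 : (l * k) * (l' * k') = 1 := by linear_combination k * k' * ul + uk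
  have F12 : (x * y) * (l' * y') = (k * x) * (l' * k') := by
    linear_combination x * l' * uy - x * l' * uk
  have F21 : (x' * y') * (l * y) = (k' * x') * (l * k) := by
    linear_combination x' * l * uy - x' * l * uk
  have F13 : (x * y) * (k' * x') = (l * y) * (l' * k') := by
    linear_combination y * k' * ux - y * k' * ul
  have F31 : (x' * y') * (k * x) = (l' * y') * (l * k) := by
    linear_combination y' * k * ux - y' * k * ul
  clear ux uy ul uk
  generalize he1 : x * y = e1 at *
  generalize he2 : l * y = e2 at *
  generalize he3 : k * x = e3 at *
  generalize he4 : l * k = e4 at *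
  generalize hf1 : x' * y' = f1 at *
  generalize hf2 : l' * y' = f2 at *
  generalize hf3 : k' * x' = f3 at *
  generalize hf4 : l' * k' = f4 at *
  set n : ℂ := (N : ℂ)
  set p : ℂ := (N' : ℂ)
  set v : ℂ := (ν : ℂ)
  set v' : ℂ := (ν' : ℂ)
  set al : ℂ := (α₀ : ℂ)
  set om : ℂ := (ω : ℂ)
  set a : ℂ := (a : ℂ)
  set b : ℂ := (b : ℂ)
  set c : ℂ := (c : ℂ)
  simp only [mul_assoc, he2, he3, hf2, hf3]
  let g := fun (n₁ k₁ n₂ k₂ : ℂ) => 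
    ((3 * n - al) * n - v * om) + (n₁ ^ 2 + om * k₁ + (al - 4 * n) * n₁)
    + (n₂ ^ 2 + om * k₂ + (al - 4 * n) * n₂) + 2 * n₁ * n₂
  linear_combination W3 + g n 0 n 0 * E1 + a ^ 2 * b ^ 2 * g (n - p) v' (n - p) v' * E2
    + b ^ 2 * c ^ 2 * g p (v - v') p (v - v') * E3 + c ^ 2 * a ^ 2 * g 0 v 0 v * E4
    + a * b * g n 0 (n - p) v' * (F12 + F21) + a * b * (e3 * f4 + f3 * e4) * W1
    + b * c * g n 0 p (v - v') * (F13 + F31) + b * c * (e2 * f4 + f2 * e4) * W2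
end

section
/- Let N > N' > 0 and ν, ν' be integers with m := Nν' − N'ν > 0, let ρ, ρ' ≥ 0, and let A, B, C be as in the coefficient formulas of Theorem 1 (with x₀ = t₀ = 0). Then for all real x₀, t₀, t, every complex root z of the polynomial z^N + A·e^{iν'ω(t₀−t)}·e^{−iN'x₀}·z^{N−N'} + B·e^{i(ν−ν')ω(t₀−t)}·e^{−i(N−N')x₀}·z^{N'} + C·e^{iνω(t₀−t)}·e^{−iNx₀} satisfies |z| < 1. That is, the N particles β₁(t), …, β_N(t) of the solutions of Theorem 1 remain in the open unit disk of the complex plane for all time. -/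
open Complex

theorem aux_disk (a b c : ℝ) (ha0 : 0 ≤ a) (ha : a ≤ 1) (hb0 : 0 ≤ b) (hb : b < 1)
    (hc0 : 0 ≤ c) (hc : c < 1) (u w e f : ℂ) (he : ‖e‖ = 1) (hf : ‖f‖ = 1)
    (hu : 1 ≤ ‖u‖) (hw : 1 ≤ ‖w‖)
    (h : u * w + (a * b : ℂ) * e * w + (b * c : ℂ) * f * u + (c * a : ℂ) * (e * f) = 0) :
    False := by
  have h1 : u * (w + (b * c : ℂ) * f) = -((a : ℂ) * e * ((b : ℂ) * w + (c : ℂ) * f)) := by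
    linear_combination h
  have h2 := congrArg norm h1
  rw [norm_neg, norm_mul, norm_mul, norm_mul, he, Complex.norm_real, Real.norm_of_nonneg ha0,
    mul_one] at h2
  have hf2 : f.re * f.re + f.im * f.im = 1 := by
    rw [← Complex.normSq_apply, Complex.normSq_eq_norm_sq, hf]; norm_num
  have hw2 : 1 ≤ w.re * w.re + w.im * w.im := by
    rw [← Complex.normSq_apply, Complex.normSq_eq_norm_sq]; nlinarith
  have h3 : ‖(b : ℂ) * w + (c : ℂ) * f‖ ^ 2 < ‖w + (b * c : ℂ) * f‖ ^ 2 := by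
    rw [← Complex.normSq_eq_norm_sq, ← Complex.normSq_eq_norm_sq, Complex.normSq_apply,
      Complex.normSq_apply]
    simp only [Complex.add_re, Complex.add_im, Complex.mul_re, Complex.mul_im,
      Complex.ofReal_re, Complex.ofReal_im]
    have hk : 0 < (1 - b ^ 2) * ((w.re * w.re + w.im * w.im) - c ^ 2) := by
      apply mul_pos <;> nlinarith
    have hk' : (1 - b ^ 2) * c ^ 2 * (f.re * f.re + f.im * f.im) = (1 - b ^ 2) * c ^ 2 := by
      rw [hf2, mul_one]
    nlinarith
  have h4 : ‖(b : ℂ) * w + (c : ℂ) * f‖ < ‖w + (b * c : ℂ) * f‖ :=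
    lt_of_pow_lt_pow_left₀ 2 (norm_nonneg _) h3
  have h5 := norm_nonneg ((b : ℂ) * w + (c : ℂ) * f)
  nlinarith

/-- The `N` particles `β₁(t), …, β_N(t)` of the solutions of Theorem 1 — the
roots of the polynomial `P(z) = z^N + Ae^{iν'ω(t₀−t)}e^{−iN'x₀}z^{N−N'} +
Be^{i(ν−ν')ω(t₀−t)}e^{−i(N−N')x₀}z^{N'} + Ce^{iνω(t₀−t)}e^{−iNx₀}` — remain in
the open unit disk of the complex plane for all time. -/
theorem particles_in_unit_disk (N N' : ℕ) (hN' : 0 < N') (hNN : N' < N)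
    (ν ν' : ℤ) (hm : 0 < (N : ℤ) * ν' - (N' : ℤ) * ν) (ρ ρ' : ℝ)
    (hρ : 0 ≤ ρ) (hρ' : 0 ≤ ρ') :
    ∀ (x₀ t₀ t : ℝ) (z : ℂ),
      z ^ N +
        ((coefA N N' ρ ρ' : ℝ) : ℂ) *
          Complex.exp (Complex.I * (ν' : ℂ) * ((omegaVal N N' ν ν' ρ' : ℝ) : ℂ) *
            ((t₀ : ℂ) - (t : ℂ))) *
          Complex.exp (-(Complex.I * (N' : ℂ) * (x₀ : ℂ))) * z ^ (N - N') +
        ((coefB N N' ρ ρ' : ℝ) : ℂ) *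
          Complex.exp (Complex.I * ((ν : ℂ) - (ν' : ℂ)) * ((omegaVal N N' ν ν' ρ' : ℝ) : ℂ) *
            ((t₀ : ℂ) - (t : ℂ))) *
          Complex.exp (-(Complex.I * ((N : ℂ) - (N' : ℂ)) * (x₀ : ℂ))) * z ^ N' +
        ((coefC N N' ρ ρ' : ℝ) : ℂ) *
          Complex.exp (Complex.I * (ν : ℂ) * ((omegaVal N N' ν ν' ρ' : ℝ) : ℂ) *
            ((t₀ : ℂ) - (t : ℂ))) *
          Complex.exp (-(Complex.I * (N : ℂ) * (x₀ : ℂ))) = 0 →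
      ‖z‖ < 1 := by
  intro x₀ t₀ t z h
  by_contra hz
  have hz1 : 1 ≤ ‖z‖ := not_lt.mp hz
  have hn : (0 : ℝ) < N' := by exact_mod_cast hN'
  have hd : (0 : ℝ) < (N : ℝ) - N' := by
    have : (N' : ℝ) < N := by exact_mod_cast hNN
    linarith
  have hp : 0 < (N' : ℝ) * ((N : ℝ) - N') := mul_pos hn hd
  have hq : 0 ≤ ((N : ℝ) + ρ') * ρ' := by positivity
  set e : ℂ := Complex.exp (((ν' * omegaVal N N' ν ν' ρ' * (t₀ - t) - N' * x₀ : ℝ) : ℂ) *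
    Complex.I) with he
  set f : ℂ := Complex.exp ((((ν - ν') * omegaVal N N' ν ν' ρ' * (t₀ - t) - (N - N') * x₀ : ℝ) :
    ℂ) * Complex.I) with hf
  refine aux_disk (Real.sqrt (((N : ℝ) - (N' : ℝ) + ρ + ρ') / ((N : ℝ) + ρ + ρ')))
    (Real.sqrt ((((N : ℝ) + ρ') * ρ') /
      ((N' : ℝ) * ((N : ℝ) - (N' : ℝ)) + ((N : ℝ) + ρ') * ρ')))
    (Real.sqrt (ρ / ((N : ℝ) - (N' : ℝ) + ρ)))
    (Real.sqrt_nonneg _) ?_ (Real.sqrt_nonneg _) ?_ (Real.sqrt_nonneg _) ?_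
    (z ^ N') (z ^ (N - N')) e f (Complex.norm_exp_ofReal_mul_I _)
    (Complex.norm_exp_ofReal_mul_I _) ?_ ?_ ?_
  · rw [Real.sqrt_le_iff, one_pow, div_le_one (by linarith)]
    exact ⟨zero_le_one, by linarith⟩
  · rw [Real.sqrt_lt' one_pos, one_pow, div_lt_one (by linarith)]
    linarith
  · rw [Real.sqrt_lt' one_pos, one_pow, div_lt_one (by linarith)]
    linarith
  · rw [norm_pow]; exact one_le_pow₀ hz1
  · rw [norm_pow]; exact one_le_pow₀ hz1
  · rw [← h]
    have hzz : z ^ N' * z ^ (N - N') = z ^ N := by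
      rw [← pow_add, Nat.add_sub_cancel' hNN.le]
    rw [hzz]
    simp only [mul_assoc _ (Complex.exp _) (Complex.exp _), ← Complex.exp_add, he, hf]
    unfold coefA coefB coefC
    push_cast
    ring_nf
end
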